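/- Let n ≥ 3, 1 < p < n, let Ω ⊆ ℝⁿ be a bounded connected open set such that ℝⁿ∖Ω is uniformly p-fat with constants c₀ and r₀, and let V ≥ 0 be locally integrable on Ω. Then the trace inequality ∫_Ω |φ(x)|^p V(x) dx ≤ C ∫_Ω |∇φ(x)|^p dx holds for all φ ∈ C_c^∞(Ω) with some constant C > 0 if and only if there exists a constant C' > 0 such that for every x ∈ Ω and every compact set K ⊆ B(x, δ(x)/100) one has ∫_K V(y) dy ≤ C' cap_p(K, Ω). -/

import Mathlib

open MeasureTheory Metric
open scoped NNReal ENNReal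

/-- The variational `p`-capacity of the condenser `(K, U)`: the infimum of `∫_U |∇φ|^p`
over Lipschitz functions `φ` with compact support contained in `U` with `φ ≥ 1` on `K`. -/
noncomputable def pCap (n : ℕ) (p : ℝ) (K U : Set (EuclideanSpace ℝ (Fin n))) : ℝ :=
  sInf { c : ℝ | ∃ φ : EuclideanSpace ℝ (Fin n) → ℝ, (∃ L : ℝ≥0, LipschitzWith L φ) ∧
    HasCompactSupport φ ∧ tsupport φ ⊆ U ∧ (∀ x ∈ K, 1 ≤ φ x) ∧
    c = ∫ x in U, ‖fderiv ℝ φ x‖ ^ p }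

/-- A closed set `E ⊆ ℝⁿ` is uniformly `p`-fat with constants `c₀, r₀ > 0` if
`cap_p(E ∩ B̄(x,r), B(x,2r)) ≥ c₀ · cap_p(B̄(x,r), B(x,2r))` for all `x ∈ ∂E`, `0 < r ≤ r₀`. -/
def UniformlyFat (n : ℕ) (p c₀ r₀ : ℝ) (E : Set (EuclideanSpace ℝ (Fin n))) : Prop :=
  ∀ x ∈ frontier E, ∀ r : ℝ, 0 < r → r ≤ r₀ →
    c₀ * pCap n p (closedBall x r) (ball x (2 * r)) ≤
      pCap n p (E ∩ closedBall x r) (ball x (2 * r))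

section Auxiliary

open Set Filter Topology

/-- Jensen's inequality for the power `p ≥ 1` and a probability measure. -/
lemma lintegral_rpow_le_lintegral_rpow {α : Type*} [MeasurableSpace α] (ν : Measure α)
    [IsProbabilityMeasure ν] {p : ℝ} (hp : 1 < p) {g : α → ℝ≥0∞} (hg : AEMeasurable g ν) :
    (∫⁻ a, g a ∂ν) ^ p ≤ ∫⁻ a, g a ^ p ∂ν := by
  have h := ENNReal.lintegral_mul_le_Lp_mul_Lq ν (Real.HolderConjugate.conjExponent hp) hg
    (aemeasurable_const (b := (1 : ℝ≥0∞)))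
  simp only [Pi.mul_apply, mul_one, ENNReal.one_rpow, lintegral_const, measure_univ] at h
  calc (∫⁻ a, g a ∂ν) ^ p ≤ ((∫⁻ a, g a ^ p ∂ν) ^ (1 / p)) ^ p := by gcongr
    _ = ∫⁻ a, g a ^ p ∂ν := by
      rw [← ENNReal.rpow_mul, one_div, inv_mul_cancel₀ (by linarith), ENNReal.rpow_one]

lemma measurable_enorm_fderiv_rpow {E : Type*} [NormedAddCommGroup E] [NormedSpace ℝ E]
    [MeasurableSpace E] [BorelSpace E] (f : E → ℝ) (p : ℝ) :
    Measurable fun x => ‖fderiv ℝ f x‖ₑ ^ p :=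
  (measurable_fderiv ℝ f).enorm.pow_const p

section Shift

variable {E : Type*} [NormedAddCommGroup E] [NormedSpace ℝ E] [FiniteDimensional ℝ E]
  [MeasureSpace E] [BorelSpace E] [(volume : Measure E).IsAddHaarMeasure]

lemma LipschitzWith.ae_enorm_sub_rpow_le {f : E → ℝ} {L : ℝ≥0} (hf : LipschitzWith L f)
    {p : ℝ} (hp : 1 < p) (h : E) :
    ∀ᵐ x : E, ‖f (x + h) - f x‖ₑ ^ p ≤
      ‖h‖ₑ ^ p * ∫⁻ t in Ioc (0 : ℝ) 1, ‖fderiv ℝ f (x + t • h)‖ₑ ^ p := by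
  have hp0 : 0 ≤ p := by linarith
  have hmeas : MeasurableSet {x : ℝ × E | DifferentiableAt ℝ f (x.2 + x.1 • h)} := by
    have hc : Measurable fun x : ℝ × E => x.2 + x.1 • h := by fun_prop
    exact hc (measurableSet_of_differentiableAt ℝ f)
  have hae : ∀ᵐ x : E, ∀ᵐ t : ℝ, DifferentiableAt ℝ f (x + t • h) := by
    refine (Measure.ae_ae_comm (p := fun (t : ℝ) (x : E) => DifferentiableAt ℝ f (x + t • h))
      hmeas).1 (Eventually.of_forall fun t => ?_)
    exact (quasiMeasurePreserving_add_right volume (t • h)).ae hf.ae_differentiableAt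
  filter_upwards [hae] with x hx
  set u : ℝ → ℝ := fun t => f (x + t • h) with hu
  have hlip : LipschitzWith (L * ‖h‖₊) u := by
    refine LipschitzWith.of_dist_le_mul fun s t => ?_
    refine (hf.dist_le_mul _ _).trans ?_
    rw [dist_add_left, dist_eq_norm, ← sub_smul, norm_smul, dist_eq_norm]
    push_cast
    exact le_of_eq (by ring)
  have hFTC : ∫ t in (0 : ℝ)..1, deriv u t = u 1 - u 0 :=
    (hlip.lipschitzOnWith.absolutelyContinuousOnInterval).integral_deriv_eq_sub
  have hmg : Measurable fun t : ℝ => ‖fderiv ℝ f (x + t • h)‖ₑ := by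
    have : Measurable fun t : ℝ => x + t • h := by fun_prop
    exact ((measurable_fderiv ℝ f).comp this).enorm
  have h1 : ‖f (x + h) - f x‖ₑ ≤ ∫⁻ t in Ioc (0 : ℝ) 1, ‖h‖ₑ * ‖fderiv ℝ f (x + t • h)‖ₑ := by
    have : f (x + h) - f x = ∫ t in Ioc (0 : ℝ) 1, deriv u t := by
      rw [← intervalIntegral.integral_of_le zero_le_one, hFTC]; simp [hu]
    rw [this]
    refine (enorm_integral_le_lintegral_enorm _).trans (lintegral_mono_ae ?_)
    filter_upwards [ae_restrict_of_ae hx] with t ht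
    have hd : HasDerivAt u (fderiv ℝ f (x + t • h) h) t := by
      have h2 : HasDerivAt (fun t : ℝ => x + t • h) h t := by
        simpa using ((hasDerivAt_id t).smul_const h).const_add x
      exact ht.hasFDerivAt.comp_hasDerivAt t h2
    rw [hd.deriv, mul_comm]
    exact ContinuousLinearMap.le_opENorm _ _
  have : IsProbabilityMeasure (volume.restrict (Ioc (0 : ℝ) 1)) := ⟨by simp⟩
  calc ‖f (x + h) - f x‖ₑ ^ p
      ≤ (∫⁻ t in Ioc (0 : ℝ) 1, ‖h‖ₑ * ‖fderiv ℝ f (x + t • h)‖ₑ) ^ p := by gcongr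
    _ ≤ ∫⁻ t in Ioc (0 : ℝ) 1, (‖h‖ₑ * ‖fderiv ℝ f (x + t • h)‖ₑ) ^ p :=
        lintegral_rpow_le_lintegral_rpow _ hp (hmg.const_mul _).aemeasurable
    _ = _ := by
        simp_rw [ENNReal.mul_rpow_of_nonneg _ _ hp0]
        rw [lintegral_const_mul _ (hmg.pow_const p)]

lemma LipschitzWith.lintegral_shift_le {f : E → ℝ} {L : ℝ≥0} (hf : LipschitzWith L f)
    {p : ℝ} (hp : 1 < p) (h : E) {B : Set E} (hB : MeasurableSet B) (hconv : Convex ℝ B) :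
    ∫⁻ x in {x | x ∈ B ∧ x + h ∈ B}, ‖f (x + h) - f x‖ₑ ^ p ≤
      ‖h‖ₑ ^ p * ∫⁻ x in B, ‖fderiv ℝ f x‖ₑ ^ p := by
  set G : E → ℝ≥0∞ := B.indicator fun x => ‖fderiv ℝ f x‖ₑ ^ p with hG
  have hGm : Measurable G := (measurable_enorm_fderiv_rpow f p).indicator hB
  have hS : MeasurableSet {x | x ∈ B ∧ x + h ∈ B} := by
    have : Measurable fun x : E => x + h := by fun_prop
    exact hB.inter (this hB)
  have hGm2 : Measurable (Function.uncurry fun (x : E) (t : ℝ) => G (x + t • h)) := by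
    have : Measurable fun q : E × ℝ => q.1 + q.2 • h := by fun_prop
    exact hGm.comp this
  calc ∫⁻ x in {x | x ∈ B ∧ x + h ∈ B}, ‖f (x + h) - f x‖ₑ ^ p
      ≤ ∫⁻ x in {x | x ∈ B ∧ x + h ∈ B}, ‖h‖ₑ ^ p * ∫⁻ t in Ioc (0 : ℝ) 1, G (x + t • h) := by
        refine lintegral_mono_ae ?_
        filter_upwards [ae_restrict_of_ae (hf.ae_enorm_sub_rpow_le hp h), ae_restrict_mem hS]
          with x hx hxS
        refine hx.trans (mul_le_mul_right (le_of_eq ?_) _)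
        refine setLIntegral_congr_fun measurableSet_Ioc fun t ht => ?_
        have : x + t • h ∈ B := by
          have := hconv hxS.1 hxS.2 (a := 1 - t) (b := t) (by linarith [ht.2]) ht.1.le (by ring)
          convert this using 1
          rw [smul_add, ← add_assoc, ← add_smul]; simp
        simp [hG, this]
    _ ≤ ∫⁻ x, ‖h‖ₑ ^ p * ∫⁻ t in Ioc (0 : ℝ) 1, G (x + t • h) := setLIntegral_le_lintegral _ _
    _ = ‖h‖ₑ ^ p * ∫⁻ x, ∫⁻ t in Ioc (0 : ℝ) 1, G (x + t • h) := by
        rw [lintegral_const_mul]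
        exact hGm2.lintegral_prod_right'
    _ = ‖h‖ₑ ^ p * ∫⁻ t in Ioc (0 : ℝ) 1, ∫⁻ x, G (x + t • h) := by
        rw [lintegral_lintegral_swap hGm2.aemeasurable]
    _ = ‖h‖ₑ ^ p * ∫⁻ x in B, ‖fderiv ℝ f x‖ₑ ^ p := by
        simp_rw [lintegral_add_right_eq_self G]
        simp [hG, lintegral_indicator hB]

/-- Friedrichs' inequality for Lipschitz functions supported in a ball. -/
lemma LipschitzWith.lintegral_rpow_le_of_support_subset_ball [Nontrivial E]
    {f : E → ℝ} {L : ℝ≥0} (hf : LipschitzWith L f)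
    {p : ℝ} (hp : 1 < p) {x₀ : E} {R : ℝ} (hR : 0 < R) (hsupp : ∀ x ∉ ball x₀ R, f x = 0) :
    ∫⁻ x, ‖f x‖ₑ ^ p ≤ ENNReal.ofReal (2 * R) ^ p * ∫⁻ x, ‖fderiv ℝ f x‖ₑ ^ p := by
  obtain ⟨h, hh⟩ := exists_norm_eq E (show 0 ≤ 2 * R by positivity)
  have hp0 : 0 < p := by linarith
  have key := hf.lintegral_shift_le hp h MeasurableSet.univ convex_univ
  simp only [mem_univ, and_self, ofPred_true, Measure.restrict_univ] at key
  have he : ‖h‖ₑ = ENNReal.ofReal (2 * R) := by rw [← hh, ofReal_norm]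
  rw [he] at key
  refine le_trans (lintegral_mono fun x => ?_) key
  by_cases hx : x ∈ ball x₀ R
  · have : f (x + h) = 0 := by
      refine hsupp _ fun hx' => ?_
      rw [mem_ball, dist_eq_norm] at hx hx'
      have : ‖h‖ ≤ ‖x + h - x₀‖ + ‖x - x₀‖ := by
        have := _root_.norm_sub_le (x + h - x₀) (x - x₀)
        simpa using this
      linarith
    simp [this]
  · simp [hsupp x hx, hp0]

/-- Poincaré's inequality on a ball, in double integral form. -/
lemma LipschitzWith.lintegral_lintegral_sub_rpow_le [Nontrivial E]
    {f : E → ℝ} {L : ℝ≥0} (hf : LipschitzWith L f) {p : ℝ} (hp : 1 < p) (z : E) (r : ℝ) :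
    ∫⁻ y in ball z r, ∫⁻ x in ball z r, ‖f y - f x‖ₑ ^ p ≤
      volume (ball (0 : E) (2 * r)) * ENNReal.ofReal (2 * r) ^ p *
        ∫⁻ x in ball z r, ‖fderiv ℝ f x‖ₑ ^ p := by
  have hp0 : 0 ≤ p := by linarith
  have hfc := hf.continuous
  set F : E → E → ℝ≥0∞ := fun y x => (ball z r).indicator 1 y * (ball z r).indicator 1 x *
    ‖f y - f x‖ₑ ^ p with hF
  have hi : Measurable ((ball z r).indicator (1 : E → ℝ≥0∞)) :=
    measurable_one.indicator measurableSet_ball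
  have hFm : Measurable (Function.uncurry F) := by
    refine ((hi.comp measurable_fst).mul (hi.comp measurable_snd)).mul ?_
    exact ((by fun_prop : Continuous fun q : E × E => f q.1 - f q.2).measurable.enorm).pow_const p
  have hind : ∀ (g : E → ℝ≥0∞), ∫⁻ x in ball z r, g x =
      ∫⁻ x, (ball z r).indicator 1 x * g x := fun g => by
    rw [← lintegral_indicator measurableSet_ball]
    congr with x
    by_cases hx : x ∈ ball z r <;> simp [hx]
  have hshift : Measurable (Function.uncurry fun x h : E => F (x + h) x) := by
    have : Measurable fun q : E × E => (q.1 + q.2, q.1) := by fun_prop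
    exact hFm.comp this
  calc ∫⁻ y in ball z r, ∫⁻ x in ball z r, ‖f y - f x‖ₑ ^ p
      = ∫⁻ y, ∫⁻ x, F y x := by
        rw [hind]
        congr with y
        rw [hind, ← lintegral_const_mul]
        · simp [hF, mul_assoc]
        · exact hi.mul ((by fun_prop : Continuous fun x : E => f y - f x).measurable.enorm.pow_const p)
    _ = ∫⁻ x, ∫⁻ y, F y x := lintegral_lintegral_swap hFm.aemeasurable
    _ = ∫⁻ x, ∫⁻ h, F (x + h) x := by
        congr with x
        exact (lintegral_add_left_eq_self (fun y => F y x) x).symm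
    _ = ∫⁻ h, ∫⁻ x, F (x + h) x := lintegral_lintegral_swap hshift.aemeasurable
    _ ≤ ∫⁻ h in ball (0 : E) (2 * r), ENNReal.ofReal (2 * r) ^ p *
          ∫⁻ x in ball z r, ‖fderiv ℝ f x‖ₑ ^ p := by
        rw [← lintegral_indicator measurableSet_ball]
        refine lintegral_mono fun h => ?_
        by_cases hh : h ∈ ball (0 : E) (2 * r)
        · rw [indicator_of_mem hh]
          have key := hf.lintegral_shift_le hp h measurableSet_ball (convex_ball z r)
          have hS : MeasurableSet {x | x ∈ ball z r ∧ x + h ∈ ball z r} := by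
            have : Measurable fun x : E => x + h := by fun_prop
            exact measurableSet_ball.inter (this measurableSet_ball)
          calc ∫⁻ x, F (x + h) x
              = ∫⁻ x in {x | x ∈ ball z r ∧ x + h ∈ ball z r}, ‖f (x + h) - f x‖ₑ ^ p := by
                rw [← lintegral_indicator hS]
                congr with x
                by_cases h1 : x ∈ ball z r <;> by_cases h2 : x + h ∈ ball z r <;>
                  simp only [hF, indicator, mem_ofPred_eq, h1, h2] <;> simp
            _ ≤ _ := key
            _ ≤ _ := by
                gcongr
                rw [mem_ball_zero_iff] at hh
                rw [← ofReal_norm]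
                exact ENNReal.ofReal_le_ofReal hh.le
        · rw [indicator_of_notMem hh]
          refine le_of_eq ?_
          rw [lintegral_eq_zero_iff (hshift.of_uncurry_right (y := h))]
          refine Eventually.of_forall fun x => ?_
          by_cases h1 : x ∈ ball z r <;> by_cases h2 : x + h ∈ ball z r
          · exfalso
            rw [mem_ball, dist_eq_norm] at h1 h2
            apply hh
            rw [mem_ball_zero_iff]
            have := _root_.norm_sub_le (x + h - z) (x - z)
            simp only [sub_sub_sub_cancel_right, add_sub_cancel_left] at this
            linarith
          all_goals simp [hF, h1, h2]
    _ = _ := by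
        rw [lintegral_const, Measure.restrict_apply_univ]; ring

end Shift

section Product

lemma LipschitzWith.mul_of_bounded {X : Type*} [PseudoMetricSpace X] {f η : X → ℝ}
    {L M D A : ℝ≥0} (hf : LipschitzWith L f) (hη : LipschitzWith M η)
    (hD : ∀ x, |η x| ≤ D) (hA : ∀ x, η x ≠ 0 → |f x| ≤ A) :
    LipschitzWith (A * M + D * L) fun x => f x * η x := by
  have aux : ∀ x y, η x ≠ 0 → |f x * η x - f y * η y| ≤ (A * M + D * L) * dist x y := by
    intro x y hx
    have h1 := hf.dist_le_mul x y
    have h2 := hη.dist_le_mul x y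
    rw [Real.dist_eq] at h1 h2
    have h3 : |f x * η x - f y * η y| ≤ |f x| * |η x - η y| + |η y| * |f x - f y| := by
      rw [← abs_mul, ← abs_mul]
      refine le_trans (le_of_eq ?_) (abs_add_le _ _)
      ring_nf
    have h4 : |f x| * |η x - η y| ≤ A * (M * dist x y) :=
      mul_le_mul (hA x hx) h2 (abs_nonneg _) A.2
    have h5 : |η y| * |f x - f y| ≤ D * (L * dist x y) :=
      mul_le_mul (hD y) h1 (abs_nonneg _) D.2
    linarith
  refine LipschitzWith.of_dist_le_mul fun x y => ?_
  rw [Real.dist_eq]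
  push_cast
  by_cases hx : η x = 0
  · by_cases hy : η y = 0
    · simp only [hx, hy, mul_zero, sub_self, abs_zero]; positivity
    · rw [abs_sub_comm, dist_comm]; exact aux y x hy
  · exact aux x y hx

lemma ENNReal.add_rpow_le {p : ℝ} (hp : 1 < p) (a b : ℝ≥0∞) :
    (a + b) ^ p ≤ 2 ^ p * (a ^ p + b ^ p) :=
  (ENNReal.rpow_add_le_mul_rpow_add_rpow a b hp.le).trans <| by
    gcongr
    · exact one_le_two
    · linarith

variable {E : Type*} [NormedAddCommGroup E] [NormedSpace ℝ E]

lemma enorm_fderiv_mul_rpow_le {f η : E → ℝ} {x : E} (hf : DifferentiableAt ℝ f x)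
    (hη : DifferentiableAt ℝ η x) {p : ℝ} (hp : 1 < p) :
    ‖fderiv ℝ (fun x => f x * η x) x‖ₑ ^ p ≤
      2 ^ p * (‖f x‖ₑ ^ p * ‖fderiv ℝ η x‖ₑ ^ p + ‖η x‖ₑ ^ p * ‖fderiv ℝ f x‖ₑ ^ p) := by
  have hp0 : 0 ≤ p := by linarith
  rw [fderiv_fun_mul hf hη, ← ENNReal.mul_rpow_of_nonneg _ _ hp0,
    ← ENNReal.mul_rpow_of_nonneg _ _ hp0, ← enorm_smul, ← enorm_smul]
  exact (ENNReal.rpow_le_rpow (enorm_add_le (f x • fderiv ℝ η x) (η x • fderiv ℝ f x))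
    hp0).trans (ENNReal.add_rpow_le hp _ _)

lemma enorm_fderiv_le_of_lipschitz {f : E → ℝ} {L : ℝ≥0} (hf : LipschitzWith L f) (x : E) :
    ‖fderiv ℝ f x‖ₑ ≤ L := by
  have := norm_fderiv_le_of_lipschitz ℝ hf (x₀ := x)
  rw [enorm_eq_nnnorm]
  exact_mod_cast this

end Product

section Cutoff

variable {E : Type*} [NormedAddCommGroup E]

/-- A radial Lipschitz cutoff equal to `1` on `closedBall z r` and to `0` off
`closedBall z (3 * r / 2)`. -/
noncomputable def radialCutoff (z : E) (r : ℝ) (x : E) : ℝ :=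
  max 0 (min 1 (3 - 2 / r * dist x z))

lemma radialCutoff_lipschitz (z : E) {r : ℝ} (hr : 0 < r) :
    LipschitzWith (Real.toNNReal (2 / r)) (radialCutoff z r) := by
  have h : LipschitzWith (Real.toNNReal (2 / r)) fun x => 3 - 2 / r * dist x z := by
    refine LipschitzWith.of_dist_le_mul fun x y => ?_
    rw [Real.dist_eq, Real.coe_toNNReal _ (by positivity)]
    have : 3 - 2 / r * dist x z - (3 - 2 / r * dist y z) =
      2 / r * (dist y z - dist x z) := by ring
    rw [this, abs_mul, abs_of_pos (by positivity : 0 < 2 / r)]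
    gcongr
    rw [dist_comm x y]
    exact abs_dist_sub_le y x z
  exact (h.const_min 1).const_max 0

lemma radialCutoff_nonneg (z : E) (r : ℝ) (x : E) : 0 ≤ radialCutoff z r x := le_max_left _ _

lemma radialCutoff_le_one (z : E) (r : ℝ) (x : E) : radialCutoff z r x ≤ 1 :=
  max_le zero_le_one (min_le_left _ _)

lemma abs_radialCutoff_le_one (z : E) (r : ℝ) (x : E) : |radialCutoff z r x| ≤ 1 := by
  rw [abs_of_nonneg (radialCutoff_nonneg z r x)]; exact radialCutoff_le_one z r x

lemma radialCutoff_eq_one {z x : E} {r : ℝ} (hr : 0 < r) (hx : dist x z ≤ r) :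
    radialCutoff z r x = 1 := by
  have : 2 / r * dist x z ≤ 2 := by
    rw [div_mul_eq_mul_div, div_le_iff₀ hr]; linarith
  rw [radialCutoff, min_eq_left (by linarith), max_eq_right zero_le_one]

lemma dist_le_of_radialCutoff_ne_zero {z x : E} {r : ℝ} (hr : 0 < r)
    (hx : radialCutoff z r x ≠ 0) : dist x z ≤ 3 * r / 2 := by
  by_contra! h
  apply hx
  have : 3 ≤ 2 / r * dist x z := by
    rw [div_mul_eq_mul_div, le_div_iff₀ hr]; linarith
  rw [radialCutoff, max_eq_left]
  exact (min_le_right _ _).trans (by linarith)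

lemma tsupport_radialCutoff_subset (z : E) {r : ℝ} (hr : 0 < r) :
    tsupport (radialCutoff z r) ⊆ closedBall z (3 * r / 2) :=
  closure_minimal (fun _ hx => dist_le_of_radialCutoff_ne_zero hr hx) isClosed_closedBall

lemma closedBall_subset_ball_two_mul (z : E) {r : ℝ} (hr : 0 < r) :
    closedBall z (3 * r / 2) ⊆ ball z (2 * r) :=
  closedBall_subset_ball (by linarith)

end Cutoff

section Capacity

variable {n : ℕ} {p : ℝ}

local notation "𝔼" => EuclideanSpace ℝ (Fin n)

lemma fderiv_eq_zero_of_notMem_tsupport {E : Type*} [NormedAddCommGroup E] [NormedSpace ℝ E]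
    {φ : E → ℝ} {x : E} (hx : x ∉ tsupport φ) : fderiv ℝ φ x = 0 := by
  by_contra h
  exact hx (support_fderiv_subset ℝ h)

lemma setLIntegral_enorm_fderiv_eq {φ : 𝔼 → ℝ} {U : Set 𝔼} (hp : 1 < p)
    (hsub : tsupport φ ⊆ U) :
    ∫⁻ x in U, ‖fderiv ℝ φ x‖ₑ ^ p = ∫⁻ x, ‖fderiv ℝ φ x‖ₑ ^ p := by
  refine setLIntegral_eq_of_support_subset fun x hx => ?_
  by_contra h
  apply hx
  have h0 : ‖fderiv ℝ φ x‖ₑ = 0 := by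
    rw [fderiv_eq_zero_of_notMem_tsupport fun h' => h (hsub h'), ← ofReal_norm, norm_zero,
      ENNReal.ofReal_zero]
  simp only [h0]
  exact ENNReal.zero_rpow_of_pos (by linarith)

lemma integrable_norm_fderiv_rpow {φ : 𝔼 → ℝ} (hp : 1 < p)
    {L : ℝ≥0} (hL : LipschitzWith L φ) (hc : HasCompactSupport φ) :
    Integrable fun x => ‖fderiv ℝ φ x‖ ^ p := by
  have h0 : Function.support (fun x => ‖fderiv ℝ φ x‖ ^ p) ⊆ tsupport φ := fun x hx => by
    by_contra h
    apply hx
    simp only [fderiv_eq_zero_of_notMem_tsupport h, norm_zero]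
    exact Real.zero_rpow (by linarith)
  rw [← integrableOn_iff_integrable_of_support_subset h0]
  refine Measure.integrableOn_of_bounded (M := (L : ℝ) ^ p) hc.isCompact.measure_lt_top.ne
    ((measurable_fderiv ℝ φ).norm.pow_const p).aestronglyMeasurable
    (Eventually.of_forall fun x => ?_)
  rw [Real.norm_of_nonneg (by positivity)]
  exact Real.rpow_le_rpow (norm_nonneg _) (norm_fderiv_le_of_lipschitz ℝ hL) (by linarith)

lemma ofReal_norm_rpow {F : Type*} [NormedAddCommGroup F] (hp : 1 < p) (x : F) :
    ENNReal.ofReal (‖x‖ ^ p) = ‖x‖ₑ ^ p := by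
  rw [← ENNReal.ofReal_rpow_of_nonneg (norm_nonneg _) (by linarith), ofReal_norm]

lemma ofReal_setIntegral_norm_fderiv {φ : 𝔼 → ℝ} {U : Set 𝔼} (hp : 1 < p)
    {L : ℝ≥0} (hL : LipschitzWith L φ) (hc : HasCompactSupport φ) (hsub : tsupport φ ⊆ U) :
    ENNReal.ofReal (∫ x in U, ‖fderiv ℝ φ x‖ ^ p) = ∫⁻ x, ‖fderiv ℝ φ x‖ₑ ^ p := by
  rw [← setLIntegral_enorm_fderiv_eq hp hsub, ofReal_integral_eq_lintegral_ofReal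
    (integrable_norm_fderiv_rpow hp hL hc).integrableOn
    (Eventually.of_forall fun x => by positivity)]
  simp_rw [ofReal_norm_rpow hp]

lemma ofReal_pCap_le {K U : Set 𝔼} (hp : 1 < p) {φ : 𝔼 → ℝ}
    {L : ℝ≥0} (hL : LipschitzWith L φ) (hc : HasCompactSupport φ) (hsub : tsupport φ ⊆ U)
    (hK : ∀ x ∈ K, 1 ≤ φ x) :
    ENNReal.ofReal (pCap n p K U) ≤ ∫⁻ x, ‖fderiv ℝ φ x‖ₑ ^ p := by
  rw [← ofReal_setIntegral_norm_fderiv hp hL hc hsub]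
  refine ENNReal.ofReal_le_ofReal (csInf_le ⟨0, ?_⟩ ⟨φ, ⟨L, hL⟩, hc, hsub, hK, rfl⟩)
  rintro c ⟨φ, -, -, -, -, rfl⟩
  exact integral_nonneg fun x => by positivity

lemma le_ofReal_pCap {K U : Set 𝔼} (hp : 1 < p) {φ₀ : 𝔼 → ℝ}
    {L₀ : ℝ≥0} (hL₀ : LipschitzWith L₀ φ₀) (hc₀ : HasCompactSupport φ₀)
    (hsub₀ : tsupport φ₀ ⊆ U) (hK₀ : ∀ x ∈ K, 1 ≤ φ₀ x) {a : ℝ≥0∞} (ha : a ≠ ⊤)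
    (h : ∀ (φ : 𝔼 → ℝ) (L : ℝ≥0), LipschitzWith L φ → HasCompactSupport φ → tsupport φ ⊆ U →
      (∀ x ∈ K, 1 ≤ φ x) → a ≤ ∫⁻ x, ‖fderiv ℝ φ x‖ₑ ^ p) :
    a ≤ ENNReal.ofReal (pCap n p K U) := by
  rw [← ENNReal.ofReal_toReal ha]
  refine ENNReal.ofReal_le_ofReal (le_csInf ⟨_, φ₀, ⟨L₀, hL₀⟩, hc₀, hsub₀, hK₀, rfl⟩ ?_)
  rintro c ⟨φ, ⟨L, hL⟩, hc, hsub, hK, rfl⟩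
  refine ENNReal.toReal_le_of_le_ofReal (integral_nonneg fun x => by positivity) ?_
  rw [ofReal_setIntegral_norm_fderiv hp hL hc hsub]
  exact h φ L hL hc hsub hK

lemma volume_ball_le_pCap (hn : 0 < n) (hp : 1 < p) (z : 𝔼) {r : ℝ} (hr : 0 < r) :
    volume (ball z r) ≤
      ENNReal.ofReal (4 * r) ^ p * ENNReal.ofReal (pCap n p (closedBall z r) (ball z (2 * r))) := by
  have : Nonempty (Fin n) := ⟨⟨0, hn⟩⟩
  have hp0 : 0 < p := by linarith
  have h4 : ENNReal.ofReal (4 * r) ^ p ≠ 0 :=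
    (ENNReal.rpow_pos (by simpa using hr) ENNReal.ofReal_ne_top).ne'
  have h4' : ENNReal.ofReal (4 * r) ^ p ≠ ⊤ :=
    ENNReal.rpow_ne_top_of_nonneg hp0.le ENNReal.ofReal_ne_top
  rw [← ENNReal.div_le_iff' h4 h4']
  have hsub := (tsupport_radialCutoff_subset z hr).trans (closedBall_subset_ball_two_mul z hr)
  refine le_ofReal_pCap hp (radialCutoff_lipschitz z hr)
    (HasCompactSupport.of_support_subset_isCompact (isCompact_closedBall z (3 * r / 2))
      fun x hx => dist_le_of_radialCutoff_ne_zero hr hx) hsub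
    (fun x hx => (radialCutoff_eq_one hr hx).ge) (ENNReal.div_ne_top measure_ball_lt_top.ne h4) ?_
  intro φ L hL hc hsub hK
  rw [ENNReal.div_le_iff' h4 h4']
  calc volume (ball z r) = ∫⁻ x in ball z r, 1 := by simp
    _ ≤ ∫⁻ x in ball z r, ‖φ x‖ₑ ^ p := by
        refine setLIntegral_mono' measurableSet_ball fun x hx => ?_
        have h1 : (1 : ℝ≥0∞) ≤ ‖φ x‖ₑ := by
          rw [← ofReal_norm, ← ENNReal.ofReal_one]
          exact ENNReal.ofReal_le_ofReal ((hK x (ball_subset_closedBall hx)).trans (le_abs_self _))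
        simpa using ENNReal.rpow_le_rpow h1 hp0.le
    _ ≤ ∫⁻ x, ‖φ x‖ₑ ^ p := setLIntegral_le_lintegral _ _
    _ ≤ ENNReal.ofReal (2 * (2 * r)) ^ p * ∫⁻ x, ‖fderiv ℝ φ x‖ₑ ^ p := by
        refine hL.lintegral_rpow_le_of_support_subset_ball hp (x₀ := z) (by positivity) ?_
        intro x hx
        by_contra h
        exact hx (hsub (subset_tsupport _ h))
    _ = _ := by ring_nf

lemma enorm_rpow_mul_pCap_le (hp : 1 < p) {F : Set 𝔼} (z : 𝔼) {r : ℝ} (hr : 0 < r)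
    {f : 𝔼 → ℝ} {L : ℝ≥0} (hf : LipschitzWith L f) (hF : ∀ x ∈ F, f x = 0) (y : 𝔼) :
    ‖f y‖ₑ ^ p * ENNReal.ofReal (pCap n p (F ∩ closedBall z r) (ball z (2 * r))) ≤
      2 ^ p * (ENNReal.ofReal (2 / r) ^ p * ∫⁻ x in ball z (2 * r), ‖f y - f x‖ₑ ^ p) +
        2 ^ p * ∫⁻ x in ball z (2 * r), ‖fderiv ℝ f x‖ₑ ^ p := by
  have hp0 : 0 < p := by linarith
  rcases eq_or_ne (f y) 0 with h0 | h0
  · simp [h0, hp0]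
  set η := radialCutoff z r with hη
  have hηl := radialCutoff_lipschitz z hr
  have hηsub := (tsupport_radialCutoff_subset z hr).trans (closedBall_subset_ball_two_mul z hr)
  set k : 𝔼 → ℝ := fun x => f y - f x with hk
  have hkl : LipschitzWith L k := by
    refine LipschitzWith.of_dist_le_mul fun a b => ?_
    simp only [hk, dist_sub_left]
    exact hf.dist_le_mul a b
  obtain ⟨A, hA⟩ := (isCompact_closedBall z (3 * r / 2)).exists_bound_of_continuousOn
    hkl.continuous.continuousOn
  have hgl : LipschitzWith _ fun x => k x * η x :=
    hkl.mul_of_bounded (D := 1) (A := A.toNNReal) hηl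
      (by simpa using abs_radialCutoff_le_one z r)
      fun x hx => (hA x (dist_le_of_radialCutoff_ne_zero hr hx)).trans (Real.le_coe_toNNReal A)
  have hψl : LipschitzWith _ fun x => (f y)⁻¹ • (k x * η x) :=
    (lipschitzWith_smul (f y)⁻¹).comp hgl
  have hgsupp : tsupport (fun x => k x * η x) ⊆ closedBall z (3 * r / 2) :=
    (closure_mono fun x hx => right_ne_zero_of_mul hx).trans (tsupport_radialCutoff_subset z hr)
  have hψsupp : tsupport (fun x => (f y)⁻¹ • (k x * η x)) ⊆ closedBall z (3 * r / 2) :=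
    (closure_mono fun x hx => right_ne_zero_of_mul hx).trans hgsupp
  have hcap := ofReal_pCap_le (K := F ∩ closedBall z r) (U := ball z (2 * r)) hp hψl
    (HasCompactSupport.intro (isCompact_closedBall z (3 * r / 2)) fun x hx => by
      by_contra h; exact hx (hψsupp (subset_tsupport _ h)))
    (hψsupp.trans (closedBall_subset_ball_two_mul z hr)) (by
      rintro x ⟨hxF, hxb⟩
      simp [hk, hF x hxF, hη, radialCutoff_eq_one hr hxb, h0])
  have hmeas : Measurable fun x => ‖f y - f x‖ₑ ^ p :=
    hkl.continuous.measurable.enorm.pow_const p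
  calc ‖f y‖ₑ ^ p * ENNReal.ofReal (pCap n p (F ∩ closedBall z r) (ball z (2 * r)))
      ≤ ‖f y‖ₑ ^ p * ∫⁻ x, ‖fderiv ℝ (fun x => (f y)⁻¹ • (k x * η x)) x‖ₑ ^ p := by gcongr
    _ = ∫⁻ x, ‖fderiv ℝ (fun x => k x * η x) x‖ₑ ^ p := by
        rw [← lintegral_const_mul _ (measurable_enorm_fderiv_rpow _ p)]
        refine lintegral_congr_ae ?_
        filter_upwards [hgl.ae_differentiableAt] with x hx
        rw [fderiv_fun_const_smul hx, ← ENNReal.mul_rpow_of_nonneg _ _ hp0.le, ← enorm_smul,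
          smul_smul, mul_inv_cancel₀ h0, one_smul]
    _ = ∫⁻ x in ball z (2 * r), ‖fderiv ℝ (fun x => k x * η x) x‖ₑ ^ p :=
        (setLIntegral_enorm_fderiv_eq hp
          (hgsupp.trans (closedBall_subset_ball_two_mul z hr))).symm
    _ ≤ ∫⁻ x in ball z (2 * r), (2 ^ p * (ENNReal.ofReal (2 / r) ^ p * ‖f y - f x‖ₑ ^ p) +
          2 ^ p * ‖fderiv ℝ f x‖ₑ ^ p) := by
        refine lintegral_mono_ae (ae_restrict_of_ae ?_)
        filter_upwards [hf.ae_differentiableAt, hηl.ae_differentiableAt] with x hx hx'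
        refine (enorm_fderiv_mul_rpow_le (hx.const_sub (f y)) hx' hp).trans ?_
        rw [mul_add, mul_comm (‖k x‖ₑ ^ p)]
        have h1 : ‖fderiv ℝ η x‖ₑ ≤ ENNReal.ofReal (2 / r) := enorm_fderiv_le_of_lipschitz hηl x
        have h2 : ‖η x‖ₑ ^ p ≤ 1 := by
          have : ‖η x‖ₑ ≤ 1 := by
            rw [← ofReal_norm, ← ENNReal.ofReal_one]
            exact ENNReal.ofReal_le_ofReal (abs_radialCutoff_le_one z r x)
          simpa using ENNReal.rpow_le_rpow this hp0.le
        have h3 : ‖fderiv ℝ k x‖ₑ = ‖fderiv ℝ f x‖ₑ := by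
          simp only [hk]; rw [fderiv_const_sub, enorm_neg]
        rw [h3]
        gcongr
        exact mul_le_of_le_one_left' h2
    _ = _ := by
        rw [lintegral_add_left ((hmeas.const_mul _).const_mul _), lintegral_const_mul,
          lintegral_const_mul _ hmeas, lintegral_const_mul _ (measurable_enorm_fderiv_rpow _ p)]
        exact hmeas.const_mul _

end Capacity

section BoundaryPoincare

variable {n : ℕ} {p : ℝ}

local notation "𝔼" => EuclideanSpace ℝ (Fin n)

lemma volume_ball_mul_radius (hn : 0 < n) (x z : 𝔼) {k r : ℝ} (hk : 0 ≤ k) (hr : 0 ≤ r) :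
    volume (ball x (k * r)) = ENNReal.ofReal k ^ n * volume (ball z r) := by
  have : Nonempty (Fin n) := ⟨⟨0, hn⟩⟩
  rw [Measure.addHaar_ball _ x (mul_nonneg hk hr), Measure.addHaar_ball _ z hr, finrank_euclideanSpace,
    Fintype.card_fin, mul_pow, ENNReal.ofReal_mul (by positivity), ENNReal.ofReal_pow hk, mul_assoc]

lemma exists_boundary_poincare (hn : 0 < n) (hp : 1 < p) {c₀ r₀ : ℝ} (hc₀ : 0 < c₀)
    {F : Set 𝔼} (hfat : UniformlyFat n p c₀ r₀ F) :
    ∃ A : ℝ≥0, ∀ z ∈ frontier F, ∀ r : ℝ, 0 < r → r ≤ r₀ → ∀ (f : 𝔼 → ℝ) (L : ℝ≥0),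
      LipschitzWith L f → (∀ x ∈ F, f x = 0) →
      ∫⁻ x in ball z (2 * r), ‖f x‖ₑ ^ p ≤
        A * ENNReal.ofReal r ^ p * ∫⁻ x in ball z (2 * r), ‖fderiv ℝ f x‖ₑ ^ p := by
  have : Nonempty (Fin n) := ⟨⟨0, hn⟩⟩
  have hp0 : 0 ≤ p := by linarith
  refine ⟨(Real.toNNReal c₀)⁻¹ * 4 ^ p * (2 ^ p * (8 ^ p * 4 ^ n + 2 ^ n)), ?_⟩
  intro z hz r hr hrr f L hf hF
  set P := ENNReal.ofReal (pCap n p (F ∩ closedBall z r) (ball z (2 * r))) with hP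
  set Q := ENNReal.ofReal (pCap n p (closedBall z r) (ball z (2 * r))) with hQ
  set v := volume (ball z r) with hv
  set I := ∫⁻ x in ball z (2 * r), ‖f x‖ₑ ^ p with hI
  set D := ∫⁻ x in ball z (2 * r), ‖fderiv ℝ f x‖ₑ ^ p with hD
  have hv0 : v ≠ 0 := (measure_ball_pos _ _ hr).ne'
  have hvt : v ≠ ⊤ := measure_ball_lt_top.ne
  have hPQ : ENNReal.ofReal c₀ * Q ≤ P := by
    rw [hP, hQ, ← ENNReal.ofReal_mul hc₀.le]
    exact ENNReal.ofReal_le_ofReal (hfat z hz r hr hrr)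
  have hvQ : v ≤ ENNReal.ofReal (4 * r) ^ p * Q := volume_ball_le_pCap hn hp z hr
  have hfm : Measurable fun y => ‖f y‖ₑ ^ p := hf.continuous.measurable.enorm.pow_const p
  have hdm : Measurable fun y => ∫⁻ x in ball z (2 * r), ‖f y - f x‖ₑ ^ p := by
    have hfc := hf.continuous
    refine Measurable.lintegral_prod_right' (f := fun q : 𝔼 × 𝔼 => ‖f q.1 - f q.2‖ₑ ^ p) ?_
    exact (by fun_prop : Continuous fun q : 𝔼 × 𝔼 => f q.1 - f q.2).measurable.enorm.pow_const p
  have h4 : ENNReal.ofReal (4 * r) = 4 * ENNReal.ofReal r := by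
    rw [ENNReal.ofReal_mul (by norm_num)]; norm_num
  have key : P * I ≤ 2 ^ p * (8 ^ p * 4 ^ n + 2 ^ n) * v * D := by
    calc P * I = ∫⁻ y in ball z (2 * r), ‖f y‖ₑ ^ p * P := by
          rw [lintegral_mul_const _ hfm, mul_comm]
      _ ≤ ∫⁻ y in ball z (2 * r), (2 ^ p * (ENNReal.ofReal (2 / r) ^ p *
            ∫⁻ x in ball z (2 * r), ‖f y - f x‖ₑ ^ p) + 2 ^ p * D) :=
          lintegral_mono fun y => enorm_rpow_mul_pCap_le hp z hr hf hF y
      _ = 2 ^ p * (ENNReal.ofReal (2 / r) ^ p * ∫⁻ y in ball z (2 * r),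
            ∫⁻ x in ball z (2 * r), ‖f y - f x‖ₑ ^ p) +
            2 ^ p * D * volume (ball z (2 * r)) := by
          rw [lintegral_add_left ((hdm.const_mul _).const_mul _),
            lintegral_const_mul _ (hdm.const_mul _), lintegral_const_mul _ hdm, lintegral_const,
            Measure.restrict_apply_univ]
      _ ≤ 2 ^ p * (ENNReal.ofReal (2 / r) ^ p * (volume (ball (0 : 𝔼) (2 * (2 * r))) *
            ENNReal.ofReal (2 * (2 * r)) ^ p * D)) + 2 ^ p * D * volume (ball z (2 * r)) := by
          gcongr
          exact hf.lintegral_lintegral_sub_rpow_le hp z (2 * r)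
      _ = 2 ^ p * ((ENNReal.ofReal (2 / r) * ENNReal.ofReal (2 * (2 * r))) ^ p * 4 ^ n + 2 ^ n)
            * v * D := by
          have e1 : volume (ball (0 : 𝔼) (2 * (2 * r))) = 4 ^ n * v := by
            rw [← mul_assoc, volume_ball_mul_radius hn 0 z (by norm_num) hr.le, ← hv]; norm_num
          have e2 : volume (ball z (2 * r)) = 2 ^ n * v := by
            rw [volume_ball_mul_radius hn z z (by norm_num) hr.le, ← hv]; norm_num
          rw [e1, e2, ENNReal.mul_rpow_of_nonneg _ _ hp0]
          ring
      _ = 2 ^ p * (8 ^ p * 4 ^ n + 2 ^ n) * v * D := by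
          rw [← ENNReal.ofReal_mul (by positivity)]
          have : 2 / r * (2 * (2 * r)) = 8 := by field_simp; norm_num
          rw [this]; norm_num
  have hc0 : ENNReal.ofReal c₀ ≠ 0 := by simpa using hc₀
  have hct : ENNReal.ofReal c₀ ≠ ⊤ := ENNReal.ofReal_ne_top
  have hfin : ENNReal.ofReal c₀ * v * I ≤ ENNReal.ofReal c₀ * v *
      ((ENNReal.ofReal c₀)⁻¹ * 4 ^ p * (2 ^ p * (8 ^ p * 4 ^ n + 2 ^ n)) *
        ENNReal.ofReal r ^ p * D) := by
    calc ENNReal.ofReal c₀ * v * I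
        ≤ ENNReal.ofReal c₀ * (ENNReal.ofReal (4 * r) ^ p * Q) * I := by gcongr
      _ = ENNReal.ofReal (4 * r) ^ p * ((ENNReal.ofReal c₀ * Q) * I) := by ring
      _ ≤ ENNReal.ofReal (4 * r) ^ p * (P * I) := by gcongr
      _ ≤ ENNReal.ofReal (4 * r) ^ p * (2 ^ p * (8 ^ p * 4 ^ n + 2 ^ n) * v * D) := by gcongr
      _ = (ENNReal.ofReal c₀ * (ENNReal.ofReal c₀)⁻¹) *
            (4 ^ p * ENNReal.ofReal r ^ p * (2 ^ p * (8 ^ p * 4 ^ n + 2 ^ n) * v * D)) := by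
          rw [ENNReal.mul_inv_cancel hc0 hct, one_mul, h4, ENNReal.mul_rpow_of_nonneg _ _ hp0]
      _ = _ := by ring
  have hfin' := (ENNReal.mul_le_mul_iff_right (mul_ne_zero hc0 hv0)
    (ENNReal.mul_ne_top hct hvt)).1 hfin
  refine hfin'.trans (le_of_eq ?_)
  have hcn : Real.toNNReal c₀ ≠ 0 := by simpa using hc₀
  push_cast [ENNReal.coe_inv hcn, ENNReal.coe_rpow_of_nonneg _ hp0]
  rfl

lemma setLIntegral_thickening_le {S : Set 𝔼} (hS : S.Nonempty) (hn : 0 < n) {r : ℝ} (hr : 0 < r)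
    {F G : 𝔼 → ℝ≥0∞} (hF : Measurable F) (hG : Measurable G) {a : ℝ≥0∞}
    (h : ∀ z ∈ S, ∫⁻ x in ball z (2 * r), F x ≤ a * ∫⁻ x in ball z (2 * r), G x) :
    ∫⁻ x in {x | infDist x S < r / 2}, F x ≤ 6 ^ n * a * ∫⁻ x in {x | infDist x S < 4 * r}, G x := by
  have : Nonempty (Fin n) := ⟨⟨0, hn⟩⟩
  set v := volume (ball (0 : 𝔼) (r / 2)) with hv
  have hv0 : v ≠ 0 := (measure_ball_pos _ _ (by positivity)).ne'
  have hvt : v ≠ ⊤ := measure_ball_lt_top.ne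
  have hdc : Continuous fun x : 𝔼 => infDist x S := continuous_infDist_pt S
  have hm : ∀ s : ℝ, MeasurableSet {x : 𝔼 | infDist x S < s} := fun s =>
    (isOpen_lt hdc continuous_const).measurableSet
  set K : 𝔼 → 𝔼 → ℝ≥0∞ := fun y x =>
    {q : 𝔼 × 𝔼 | infDist q.1 S < r ∧ dist q.1 q.2 < r}.indicator 1 (y, x) * F x with hK
  set M : 𝔼 → 𝔼 → ℝ≥0∞ := fun y x =>
    {q : 𝔼 × 𝔼 | infDist q.2 S < 4 * r ∧ dist q.1 q.2 < 3 * r}.indicator 1 (y, x) * G x with hM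
  have hs1 : MeasurableSet {q : 𝔼 × 𝔼 | infDist q.1 S < r ∧ dist q.1 q.2 < r} :=
    ((isOpen_lt (hdc.comp continuous_fst) continuous_const).inter
      (isOpen_lt continuous_dist continuous_const)).measurableSet
  have hs2 : MeasurableSet {q : 𝔼 × 𝔼 | infDist q.2 S < 4 * r ∧ dist q.1 q.2 < 3 * r} :=
    ((isOpen_lt (hdc.comp continuous_snd) continuous_const).inter
      (isOpen_lt continuous_dist continuous_const)).measurableSet
  have hKm : Measurable (Function.uncurry K) :=
    (measurable_one.indicator hs1).mul (hF.comp measurable_snd)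
  have hMm : Measurable (Function.uncurry M) :=
    (measurable_one.indicator hs2).mul (hG.comp measurable_snd)
  have h1 : v * ∫⁻ x in {x | infDist x S < r / 2}, F x ≤ ∫⁻ y, ∫⁻ x, K y x := by
    rw [lintegral_lintegral_swap hKm.aemeasurable, ← lintegral_const_mul _ hF,
      ← lintegral_indicator (hm _)]
    refine lintegral_mono fun x => ?_
    by_cases hx : infDist x S < r / 2
    · rw [indicator_of_mem (show x ∈ {x | infDist x S < r / 2} from hx)]
      calc v * F x = ∫⁻ y in ball x (r / 2), F x := by
            rw [lintegral_const, Measure.restrict_apply_univ, mul_comm, hv,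
              Measure.addHaar_ball_center _ x]
        _ ≤ ∫⁻ y in ball x (r / 2), K y x := by
            refine setLIntegral_mono' measurableSet_ball fun y hy => ?_
            have : (y, x) ∈ {q : 𝔼 × 𝔼 | infDist q.1 S < r ∧ dist q.1 q.2 < r} := by
              rw [mem_ball] at hy
              have := infDist_le_infDist_add_dist (s := S) (x := y) (y := x)
              exact ⟨by simp only; linarith, by simp only; linarith⟩
            simp only [hK]
            rw [indicator_of_mem this]; simp
        _ ≤ ∫⁻ y, K y x := setLIntegral_le_lintegral _ _
    · rw [indicator_of_notMem (show x ∉ {x | infDist x S < r / 2} from hx)]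
      exact zero_le
  have h2 : ∀ y, ∫⁻ x, K y x ≤ a * ∫⁻ x, M y x := by
    intro y
    by_cases hy : infDist y S < r
    · obtain ⟨z, hz, hyz⟩ := (infDist_lt_iff hS).1 hy
      calc ∫⁻ x, K y x ≤ ∫⁻ x in ball z (2 * r), F x := by
            rw [← lintegral_indicator measurableSet_ball]
            refine lintegral_mono fun x => ?_
            by_cases hx : dist y x < r
            · have : x ∈ ball z (2 * r) := by
                rw [mem_ball]
                have := dist_triangle x y z
                rw [dist_comm x y] at this
                linarith
              rw [indicator_of_mem this]
              exact mul_le_of_le_one_left' (indicator_le_self' (fun _ _ => zero_le) _)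
            · simp only [hK]
              rw [indicator_of_notMem (fun hq => hx hq.2), zero_mul]
              exact zero_le
        _ ≤ a * ∫⁻ x in ball z (2 * r), G x := h z hz
        _ ≤ a * ∫⁻ x, M y x := by
            refine mul_le_mul_right ?_ a
            rw [← lintegral_indicator measurableSet_ball]
            refine lintegral_mono fun x => ?_
            by_cases hx : x ∈ ball z (2 * r)
            · have : (y, x) ∈ {q : 𝔼 × 𝔼 | infDist q.2 S < 4 * r ∧ dist q.1 q.2 < 3 * r} := by
                rw [mem_ball] at hx
                have h3 := dist_triangle y z x
                rw [dist_comm z x] at h3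
                have h4 := infDist_le_dist_of_mem (x := x) hz
                exact ⟨by simp only; linarith, by simp only; linarith⟩
              rw [indicator_of_mem hx]
              simp only [hM]
              rw [indicator_of_mem this]; simp
            · rw [indicator_of_notMem hx]; exact zero_le
    · have : ∀ x, K y x = 0 := fun x => by
        simp only [hK]
        rw [indicator_of_notMem (fun hq => hy hq.1), zero_mul]
      simp [this]
  have h3 : ∫⁻ y, ∫⁻ x, M y x ≤ 6 ^ n * v * ∫⁻ x in {x | infDist x S < 4 * r}, G x := by
    rw [lintegral_lintegral_swap hMm.aemeasurable, ← lintegral_const_mul _ hG,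
      ← lintegral_indicator (hm _)]
    refine lintegral_mono fun x => ?_
    by_cases hx : infDist x S < 4 * r
    · rw [indicator_of_mem (show x ∈ {x | infDist x S < 4 * r} from hx)]
      calc ∫⁻ y, M y x ≤ ∫⁻ y in ball x (3 * r), G x := by
            rw [← lintegral_indicator measurableSet_ball]
            refine lintegral_mono fun y => ?_
            by_cases hy : y ∈ ball x (3 * r)
            · rw [indicator_of_mem hy]
              exact mul_le_of_le_one_left' (indicator_le_self' (fun _ _ => zero_le) _)
            · simp only [hM]
              rw [indicator_of_notMem (fun hq => hy hq.2), zero_mul]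
              exact zero_le
        _ = 6 ^ n * v * G x := by
            rw [lintegral_const, Measure.restrict_apply_univ, mul_comm,
              show 3 * r = 6 * (r / 2) by ring,
              volume_ball_mul_radius hn x 0 (by norm_num) (by positivity), ← hv]
            norm_num
    · have : ∀ y, M y x = 0 := fun y => by
        simp only [hM]
        rw [indicator_of_notMem (fun hq => hx hq.1), zero_mul]
      simp [this]
  refine (ENNReal.mul_le_mul_iff_right hv0 hvt).1 ?_
  calc v * ∫⁻ x in {x | infDist x S < r / 2}, F x ≤ ∫⁻ y, ∫⁻ x, K y x := h1
    _ ≤ ∫⁻ y, a * ∫⁻ x, M y x := lintegral_mono h2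
    _ = a * ∫⁻ y, ∫⁻ x, M y x := lintegral_const_mul _ hMm.lintegral_prod_right'
    _ ≤ a * (6 ^ n * v * ∫⁻ x in {x | infDist x S < 4 * r}, G x) := by gcongr
    _ = _ := by ring

end BoundaryPoincare

section Weights

variable {p : ℝ}

lemma ofReal_rpow_le_lintegral_tail (hp : 1 < p) {ε d s₀ : ℝ} (hε : 0 < ε) (hε1 : ε ≤ 1)
    (hd : 0 < d) (hds : d < s₀ / 2) :
    ENNReal.ofReal (d ^ (-p - ε)) ≤
      2 ^ (p + 2) * ∫⁻ s in Ioc 0 s₀, (Ioi d).indicator (fun s => ENNReal.ofReal (s ^ (-p - ε - 1))) s := by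
  have h1 : ENNReal.ofReal (d * (2 * d) ^ (-p - ε - 1)) ≤
      ∫⁻ s in Ioc 0 s₀, (Ioi d).indicator (fun s => ENNReal.ofReal (s ^ (-p - ε - 1))) s := by
    calc ENNReal.ofReal (d * (2 * d) ^ (-p - ε - 1))
        = ∫⁻ s in Ioc d (2 * d), ENNReal.ofReal ((2 * d) ^ (-p - ε - 1)) := by
          rw [lintegral_const, Measure.restrict_apply_univ, Real.volume_Ioc, mul_comm d,
            ENNReal.ofReal_mul (by positivity)]
          congr 2; ring
      _ ≤ ∫⁻ s in Ioc d (2 * d), (Ioi d).indicator (fun s => ENNReal.ofReal (s ^ (-p - ε - 1))) s := by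
          refine setLIntegral_mono' measurableSet_Ioc fun s hs => ?_
          rw [indicator_of_mem (show s ∈ Ioi d from hs.1)]
          exact ENNReal.ofReal_le_ofReal
            (Real.rpow_le_rpow_of_nonpos (hd.trans hs.1) hs.2 (by linarith))
      _ ≤ _ := lintegral_mono_set
          (show Ioc d (2 * d) ⊆ Ioc 0 s₀ from fun s hs => ⟨hd.trans hs.1, by linarith [hs.2]⟩)
  refine le_trans ?_ (mul_le_mul_right h1 _)
  have h2 : (2 : ℝ≥0∞) ^ (p + 2) = ENNReal.ofReal (2 ^ (p + 2)) := by
    rw [← ENNReal.ofReal_rpow_of_pos two_pos]; norm_num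
  rw [h2, ← ENNReal.ofReal_mul (by positivity)]
  refine ENNReal.ofReal_le_ofReal ?_
  have h3 : d * (2 * d) ^ (-p - ε - 1) = 2 ^ (-p - ε - 1) * d ^ (-p - ε) := by
    rw [Real.mul_rpow two_pos.le hd.le, Real.rpow_sub_one hd.ne']; field_simp
  rw [h3, ← mul_assoc, ← Real.rpow_add two_pos]
  have : (1 : ℝ) ≤ 2 ^ (p + 2 + (-p - ε - 1)) := Real.one_le_rpow one_le_two (by linarith)
  exact le_mul_of_one_le_left (by positivity) this

lemma lintegral_tail_le_ofReal_rpow {ε d s₀ : ℝ} (hε : 0 < ε) (hε1 : ε ≤ 1) (hd : 0 < d) :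
    ∫⁻ s in Ioc 0 s₀, (Ioi (d / 8)).indicator (fun s => ENNReal.ofReal (s ^ (-ε - 1))) s ≤
      8 * ENNReal.ofReal ε⁻¹ * ENNReal.ofReal (d ^ (-ε)) := by
  have hd8 : 0 < d / 8 := by positivity
  calc ∫⁻ s in Ioc 0 s₀, (Ioi (d / 8)).indicator (fun s => ENNReal.ofReal (s ^ (-ε - 1))) s
      ≤ ∫⁻ s, (Ioi (d / 8)).indicator (fun s => ENNReal.ofReal (s ^ (-ε - 1))) s :=
        setLIntegral_le_lintegral _ _
    _ = ∫⁻ s in Ioi (d / 8), ENNReal.ofReal (s ^ (-ε - 1)) := lintegral_indicator measurableSet_Ioi _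
    _ = ENNReal.ofReal (∫ s in Ioi (d / 8), s ^ (-ε - 1)) := by
        rw [ofReal_integral_eq_lintegral_ofReal
          (integrableOn_Ioi_rpow_of_lt (by linarith) hd8)]
        filter_upwards [ae_restrict_mem measurableSet_Ioi] with s hs
        exact Real.rpow_nonneg (hd8.trans hs).le _
    _ = ENNReal.ofReal ((d / 8) ^ (-ε) * ε⁻¹) := by
        rw [integral_Ioi_rpow_of_lt (by linarith) hd8]
        congr 1
        rw [sub_add_cancel]
        field_simp
    _ ≤ ENNReal.ofReal (8 * ε⁻¹ * d ^ (-ε)) := by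
        refine ENNReal.ofReal_le_ofReal ?_
        rw [Real.div_rpow hd.le (by norm_num), Real.rpow_neg (by norm_num : (0 : ℝ) ≤ 8),
          div_inv_eq_mul]
        have : (8 : ℝ) ^ ε ≤ 8 := by
          simpa using Real.rpow_le_rpow_of_exponent_le (by norm_num : (1 : ℝ) ≤ 8) hε1
        have h0 : 0 ≤ d ^ (-ε) * ε⁻¹ := by positivity
        nlinarith [mul_le_mul_of_nonneg_right this h0]
    _ = _ := by
        rw [ENNReal.ofReal_mul (by positivity), ENNReal.ofReal_mul (by positivity)]
        norm_num

/-- Integrating a family of boundary layer inequalities against a power of the layer width. -/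
lemma lintegral_weight_le_of_layers {X : Type*} [MeasurableSpace X] (μ : Measure X) [SFinite μ]
    (hp : 1 < p) {ε s₀ : ℝ} (hε : 0 < ε) (hε1 : ε ≤ 1)
    {d : X → ℝ} (hdm : Measurable d) (hd : ∀ᵐ x ∂μ, 0 < d x)
    {F G : X → ℝ≥0∞} (hF : Measurable F) (hG : Measurable G) {A : ℝ≥0∞}
    (h : ∀ s, 0 < s → s ≤ s₀ →
      ∫⁻ x in {x | d x < s}, F x ∂μ ≤ A * ENNReal.ofReal s ^ p * ∫⁻ x in {x | d x < 8 * s}, G x ∂μ) :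
    ∫⁻ x in {x | d x < s₀ / 2}, F x * ENNReal.ofReal (d x ^ (-p - ε)) ∂μ ≤
      2 ^ (p + 2) * A * 8 * ENNReal.ofReal ε⁻¹ * ∫⁻ x, G x * ENNReal.ofReal (d x ^ (-ε)) ∂μ := by
  have hm : ∀ s : ℝ, MeasurableSet {x | d x < s} := fun s => measurableSet_lt hdm measurable_const
  set K : X → ℝ → ℝ≥0∞ := fun x s =>
    F x * (Ioi (d x)).indicator (fun s => ENNReal.ofReal (s ^ (-p - ε - 1))) s with hK
  set M : X → ℝ → ℝ≥0∞ := fun x s =>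
    G x * (Ioi (d x / 8)).indicator (fun s => ENNReal.ofReal (s ^ (-ε - 1))) s with hM
  have hind : ∀ (c : ℝ → ℝ≥0∞) (_ : Measurable c) (e : X → ℝ) (_ : Measurable e),
      Measurable fun q : X × ℝ => (Ioi (e q.1)).indicator c q.2 := by
    intro c hc e he
    exact (hc.comp measurable_snd).indicator
      (measurableSet_lt (he.comp measurable_fst) measurable_snd)
  have hpow : ∀ e : ℝ, Measurable fun s : ℝ => ENNReal.ofReal (s ^ e) := fun e => by fun_prop
  have hKm : Measurable (Function.uncurry K) :=
    (hF.comp measurable_fst).mul (hind _ (hpow _) d hdm)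
  have hMm : Measurable (Function.uncurry M) :=
    (hG.comp measurable_fst).mul (hind _ (hpow _) (fun x => d x / 8) (hdm.div_const 8))
  calc ∫⁻ x in {x | d x < s₀ / 2}, F x * ENNReal.ofReal (d x ^ (-p - ε)) ∂μ
      ≤ ∫⁻ x in {x | d x < s₀ / 2}, (2 ^ (p + 2) * ∫⁻ s in Ioc 0 s₀, K x s) ∂μ := by
        refine lintegral_mono_ae ?_
        filter_upwards [ae_restrict_of_ae hd, ae_restrict_mem (hm _)] with x hx hxs
        rw [lintegral_const_mul _ ((hpow _).indicator measurableSet_Ioi)]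
        calc F x * ENNReal.ofReal (d x ^ (-p - ε)) ≤ F x * _ :=
              mul_le_mul_right (ofReal_rpow_le_lintegral_tail hp hε hε1 hx hxs) _
          _ = _ := by ring
    _ ≤ ∫⁻ x, (2 ^ (p + 2) * ∫⁻ s in Ioc 0 s₀, K x s) ∂μ := setLIntegral_le_lintegral _ _
    _ = 2 ^ (p + 2) * ∫⁻ s in Ioc 0 s₀, ∫⁻ x, K x s ∂μ := by
        rw [lintegral_const_mul, lintegral_lintegral_swap hKm.aemeasurable]
        exact hKm.lintegral_prod_right'
    _ ≤ 2 ^ (p + 2) * ∫⁻ s in Ioc 0 s₀, A * ∫⁻ x, M x s ∂μ := by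
        refine mul_le_mul_right (setLIntegral_mono' measurableSet_Ioc fun s hs => ?_) _
        have e1 : ∫⁻ x, K x s ∂μ =
            ENNReal.ofReal (s ^ (-p - ε - 1)) * ∫⁻ x in {x | d x < s}, F x ∂μ := by
          rw [← lintegral_const_mul _ hF, ← lintegral_indicator (hm _)]
          congr with x
          by_cases hx : d x < s
          · rw [indicator_of_mem (show x ∈ {x | d x < s} from hx)]
            simp only [hK]; rw [indicator_of_mem (show s ∈ Ioi (d x) from hx), mul_comm]
          · rw [indicator_of_notMem (show x ∉ {x | d x < s} from hx)]
            simp only [hK]; rw [indicator_of_notMem (show s ∉ Ioi (d x) from hx), mul_zero]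
        have e2 : ∫⁻ x, M x s ∂μ =
            ENNReal.ofReal (s ^ (-ε - 1)) * ∫⁻ x in {x | d x < 8 * s}, G x ∂μ := by
          rw [← lintegral_const_mul _ hG, ← lintegral_indicator (hm _)]
          congr with x
          have hiff : s ∈ Ioi (d x / 8) ↔ x ∈ {x | d x < 8 * s} := by
            rw [mem_Ioi, mem_ofPred_eq, div_lt_iff₀ (by norm_num), mul_comm]
          by_cases hx : x ∈ {x | d x < 8 * s}
          · rw [indicator_of_mem hx]
            simp only [hM]; rw [indicator_of_mem (hiff.2 hx), mul_comm]
          · rw [indicator_of_notMem hx]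
            simp only [hM]; rw [indicator_of_notMem (fun h => hx (hiff.1 h)), mul_zero]
        rw [e1, e2]
        have e3 : ENNReal.ofReal (s ^ (-p - ε - 1)) * ENNReal.ofReal s ^ p =
            ENNReal.ofReal (s ^ (-ε - 1)) := by
          rw [ENNReal.ofReal_rpow_of_pos hs.1,
            ← ENNReal.ofReal_mul (Real.rpow_nonneg hs.1.le _), ← Real.rpow_add hs.1]
          ring_nf
        calc _ ≤ ENNReal.ofReal (s ^ (-p - ε - 1)) * (A * ENNReal.ofReal s ^ p *
              ∫⁻ x in {x | d x < 8 * s}, G x ∂μ) := mul_le_mul_right (h s hs.1 hs.2) _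
          _ = A * ((ENNReal.ofReal (s ^ (-p - ε - 1)) * ENNReal.ofReal s ^ p) *
              ∫⁻ x in {x | d x < 8 * s}, G x ∂μ) := by ring
          _ = _ := by rw [e3]
    _ = 2 ^ (p + 2) * A * ∫⁻ x, (∫⁻ s in Ioc 0 s₀, M x s) ∂μ := by
        rw [lintegral_const_mul, lintegral_lintegral_swap hMm.aemeasurable, mul_assoc]
        exact hMm.lintegral_prod_left' (μ := μ)
    _ ≤ 2 ^ (p + 2) * A * ∫⁻ x, 8 * ENNReal.ofReal ε⁻¹ * (G x * ENNReal.ofReal (d x ^ (-ε))) ∂μ := by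
        refine mul_le_mul_right (lintegral_mono_ae ?_) _
        filter_upwards [hd] with x hx
        rw [lintegral_const_mul _ ((hpow _).indicator measurableSet_Ioi)]
        calc _ ≤ G x * _ := mul_le_mul_right (lintegral_tail_le_ofReal_rpow hε hε1 hx) _
          _ = _ := by ring
    _ = _ := by
        rw [lintegral_const_mul]
        · ring
        · exact hG.mul (by fun_prop)

end Weights

section Domain

variable {n : ℕ} {p : ℝ}

local notation "𝔼" => EuclideanSpace ℝ (Fin n)

lemma frontier_nonempty_of_isBounded (hn : 0 < n) {Ω : Set 𝔼} (hb : Bornology.IsBounded Ω)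
    (hne : Ω.Nonempty) : (frontier Ω).Nonempty := by
  have : Nonempty (Fin n) := ⟨⟨0, hn⟩⟩
  by_contra h
  rw [not_nonempty_iff_eq_empty, ← isClopen_iff_frontier_eq_empty, isClopen_iff] at h
  rcases h with h | h
  · exact hne.ne_empty h
  · exact NormedSpace.unbounded_univ ℝ 𝔼 (h ▸ hb)

lemma infDist_frontier_pos (hn : 0 < n) {Ω : Set 𝔼} (hb : Bornology.IsBounded Ω)
    (hopen : IsOpen Ω) {x : 𝔼} (hx : x ∈ Ω) : 0 < infDist x (frontier Ω) := by
  refine (isClosed_frontier.notMem_iff_infDist_pos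
    (frontier_nonempty_of_isBounded hn hb ⟨x, hx⟩)).1 fun h => ?_
  rw [hopen.frontier_eq] at h
  exact h.2 hx

lemma ball_infDist_frontier_subset {Ω : Set 𝔼} (hopen : IsOpen Ω) {x : 𝔼} (hx : x ∈ Ω) :
    ball x (infDist x (frontier Ω)) ⊆ Ω := by
  rcases le_or_gt (infDist x (frontier Ω)) 0 with h0 | h0
  · simp [ball_eq_empty.2 h0]
  refine (convex_ball x (infDist x (frontier Ω))).isPreconnected.subset_left_of_subset_union
    hopen isClosed_closure.isOpen_compl
    (disjoint_compl_right.mono_left subset_closure) (fun y hy => ?_) ⟨x, mem_ball_self h0, hx⟩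
  by_cases hyΩ : y ∈ Ω
  · exact Or.inl hyΩ
  refine Or.inr fun hyc => (infDist_le_dist_of_mem (x := x) (y := y) (s := frontier Ω) ?_).not_gt
    (by rwa [dist_comm])
  rw [hopen.frontier_eq]
  exact ⟨hyc, hyΩ⟩

end Domain

lemma setLIntegral_restrict_eq_of_forall_notMem {X : Type*} [MeasurableSpace X] {μ : Measure X}
    {G : X → ℝ≥0∞} {S Ω : Set X} (hS : MeasurableSet S) (hG : ∀ x ∉ Ω, G x = 0) :
    ∫⁻ x in S, G x ∂(μ.restrict Ω) = ∫⁻ x in S, G x ∂μ := by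
  rw [Measure.restrict_comm hS]
  refine setLIntegral_eq_of_support_subset fun x hx => ?_
  by_contra h
  exact hx (hG x h)

section Hardy

variable {n : ℕ} {p : ℝ}

local notation "𝔼" => EuclideanSpace ℝ (Fin n)

lemma measurableSet_infDist_lt (S : Set 𝔼) (s : ℝ) : MeasurableSet {x : 𝔼 | infDist x S < s} :=
  measurableSet_lt (continuous_infDist_pt S).measurable measurable_const

lemma enorm_fderiv_rpow_eq_zero {E : Type*} [NormedAddCommGroup E] [NormedSpace ℝ E] (hp : 1 < p)
    {f : E → ℝ} {x : E} (h : fderiv ℝ f x = 0) : ‖fderiv ℝ f x‖ₑ ^ p = 0 := by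
  rw [h, ← ofReal_norm, norm_zero, ENNReal.ofReal_zero]
  exact ENNReal.zero_rpow_of_pos (by linarith)

lemma ofReal_rpow_neg_le_of_le {ε d s : ℝ} (hp : 1 < p) (hε : 0 < ε) (hε1 : ε ≤ 1) (hs : 0 < s)
    (hd : s ≤ d) : ENNReal.ofReal (d ^ (-p - ε)) ≤ ENNReal.ofReal (max 1 s⁻¹ ^ (p + 1)) := by
  refine ENNReal.ofReal_le_ofReal ?_
  have hd0 := hs.trans_le hd
  rw [show -p - ε = -(p + ε) by ring, Real.rpow_neg hd0.le, ← Real.inv_rpow hd0.le]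
  calc d⁻¹ ^ (p + ε) ≤ max 1 s⁻¹ ^ (p + ε) :=
        Real.rpow_le_rpow (by positivity)
          ((inv_anti₀ hs hd).trans (le_max_right _ _)) (by linarith)
    _ ≤ _ := Real.rpow_le_rpow_of_exponent_le (le_max_left _ _) (by linarith)

lemma one_le_ofReal_mul_rpow_neg {ε d D : ℝ} (hε : 0 < ε) (hε1 : ε ≤ 1) (hd : 0 < d)
    (hdD : d ≤ D) : 1 ≤ ENNReal.ofReal (max 1 D) * ENNReal.ofReal (d ^ (-ε)) := by
  rw [← ENNReal.ofReal_mul (by positivity), ENNReal.one_le_ofReal, Real.rpow_neg hd.le,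
    ← div_eq_mul_inv, one_le_div (by positivity)]
  calc d ^ ε ≤ max 1 D ^ ε := Real.rpow_le_rpow hd.le (hdD.trans (le_max_right _ _)) hε.le
    _ ≤ max 1 D ^ (1 : ℝ) := Real.rpow_le_rpow_of_exponent_le (le_max_left _ _) hε1
    _ = _ := Real.rpow_one _

/-- Hardy's inequality with the additional singular weight `d ^ (-ε)` on both sides and the
constant `A / ε`. -/
lemma exists_weighted_hardy (hn : 0 < n) (hp : 1 < p) {Ω : Set 𝔼} (hb : Bornology.IsBounded Ω)
    (hopen : IsOpen Ω) (hne : Ω.Nonempty) {c₀ r₀ : ℝ} (hc₀ : 0 < c₀) (hr₀ : 0 < r₀)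
    (hfat : UniformlyFat n p c₀ r₀ Ωᶜ) :
    ∃ A : ℝ≥0, ∀ ε : ℝ, 0 < ε → ε ≤ 1 → ∀ (f : 𝔼 → ℝ) (L : ℝ≥0), LipschitzWith L f →
      tsupport f ⊆ Ω →
      ∫⁻ x in Ω, ‖f x‖ₑ ^ p * ENNReal.ofReal (infDist x (frontier Ω) ^ (-p - ε)) ≤
        A * ENNReal.ofReal ε⁻¹ *
          ∫⁻ x in Ω, ‖fderiv ℝ f x‖ₑ ^ p * ENNReal.ofReal (infDist x (frontier Ω) ^ (-ε)) := by
  have : Nonempty (Fin n) := ⟨⟨0, hn⟩⟩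
  have hp0 : 0 < p := by linarith
  obtain ⟨A, hA⟩ := exists_boundary_poincare hn hp hc₀ hfat
  rw [frontier_compl] at hA
  obtain ⟨x₀, hx₀⟩ := hne
  obtain ⟨R, hR, hΩR⟩ := hb.subset_ball_lt 0 x₀
  have hfn := frontier_nonempty_of_isBounded hn hb ⟨x₀, hx₀⟩
  set d : 𝔼 → ℝ := fun x => infDist x (frontier Ω) with hd
  have hdm : Measurable d := (continuous_infDist_pt _).measurable
  have hdpos : ∀ x ∈ Ω, 0 < d x := fun x hx => infDist_frontier_pos hn hb hopen hx
  have hdR : ∀ x ∈ Ω, d x ≤ 2 * R := by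
    intro x hx
    obtain ⟨z, hz⟩ := hfn
    have h1 : dist z x₀ ≤ R :=
      closure_ball_subset_closedBall (closure_mono hΩR (frontier_subset_closure hz))
    have h2 : dist x x₀ < R := hΩR hx
    have h3 := infDist_le_dist_of_mem (x := x) hz
    have h4 := dist_triangle_right x z x₀
    simp only [hd]
    linarith
  set B₁ : ℝ≥0∞ := 2 ^ (p + 2) * (6 ^ n * A * 2 ^ p) * 8 with hB₁
  set B₂ : ℝ≥0∞ := ENNReal.ofReal (max 1 (r₀ / 4)⁻¹ ^ (p + 1)) * ENNReal.ofReal (2 * R) ^ p *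
    ENNReal.ofReal (max 1 (2 * R)) with hB₂
  have hB : B₁ + B₂ ≠ ⊤ := by
    have : ∀ e : ℝ, (2 : ℝ≥0∞) ^ e ≠ ⊤ := fun e =>
      ENNReal.rpow_ne_top_of_ne_zero two_ne_zero ENNReal.ofNat_ne_top
    have h6 : (6 : ℝ≥0∞) ^ n ≠ ⊤ := ENNReal.pow_ne_top ENNReal.ofNat_ne_top
    refine ENNReal.add_ne_top.2 ⟨?_, ?_⟩
    · exact ENNReal.mul_ne_top (ENNReal.mul_ne_top (this _) (ENNReal.mul_ne_top
        (ENNReal.mul_ne_top h6 ENNReal.coe_ne_top) (this _))) ENNReal.ofNat_ne_top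
    · exact ENNReal.mul_ne_top (ENNReal.mul_ne_top ENNReal.ofReal_ne_top
        (ENNReal.rpow_ne_top_of_nonneg hp0.le ENNReal.ofReal_ne_top)) ENNReal.ofReal_ne_top
  refine ⟨(B₁ + B₂).toNNReal, fun ε hε hε1 f L hf hsupp => ?_⟩
  rw [ENNReal.coe_toNNReal hB]
  have hf0 : ∀ x ∉ Ω, f x = 0 := fun x hx => image_eq_zero_of_notMem_tsupport fun h => hx (hsupp h)
  set F : 𝔼 → ℝ≥0∞ := fun x => ‖f x‖ₑ ^ p with hF
  set G : 𝔼 → ℝ≥0∞ := fun x => ‖fderiv ℝ f x‖ₑ ^ p with hG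
  have hFm : Measurable F := (hf.continuous.measurable.enorm).pow_const p
  have hGm : Measurable G := measurable_enorm_fderiv_rpow f p
  have hG0 : ∀ x ∉ Ω, G x = 0 := fun x hx => enorm_fderiv_rpow_eq_zero hp
    (fderiv_eq_zero_of_notMem_tsupport fun h => hx (hsupp h))
  have hlayer : ∀ s, 0 < s → s ≤ r₀ / 2 →
      ∫⁻ x in {x | d x < s}, F x ∂(volume.restrict Ω) ≤ 6 ^ n * A * 2 ^ p * ENNReal.ofReal s ^ p *
        ∫⁻ x in {x | d x < 8 * s}, G x ∂(volume.restrict Ω) := by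
    intro s hs hs'
    rw [setLIntegral_restrict_eq_of_forall_notMem (measurableSet_infDist_lt _ _) hG0]
    have key := setLIntegral_thickening_le (S := frontier Ω) hfn hn (r := 2 * s) (by positivity)
      hFm hGm (fun z hz => hA z hz (2 * s) (by positivity) (by linarith) f L hf
        fun x hx => hf0 x hx)
    rw [show 2 * s / 2 = s by ring, show 4 * (2 * s) = 8 * s by ring,
      ENNReal.ofReal_mul two_pos.le, ENNReal.mul_rpow_of_nonneg _ _ hp0.le,
      ENNReal.ofReal_ofNat] at key
    refine (lintegral_mono' (Measure.restrict_mono le_rfl Measure.restrict_le_self) le_rfl).trans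
      (key.trans (le_of_eq ?_))
    ring
  have hnear := lintegral_weight_le_of_layers (volume.restrict Ω) hp hε hε1 hdm
    ((ae_restrict_iff' hopen.measurableSet).2 (Eventually.of_forall hdpos)) hFm hGm hlayer
  set I : ℝ≥0∞ := ∫⁻ x in Ω, G x * ENNReal.ofReal (d x ^ (-ε)) with hI
  have hε' : 1 ≤ ENNReal.ofReal ε⁻¹ := by
    rw [ENNReal.one_le_ofReal]; exact (one_le_inv₀ hε).2 hε1
  have hfar : ∫⁻ x in {x | d x < r₀ / 2 / 2}ᶜ, F x * ENNReal.ofReal (d x ^ (-p - ε))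
      ∂(volume.restrict Ω) ≤ B₂ * I := by
    have hms : MeasurableSet {x | d x < r₀ / 2 / 2} := measurableSet_infDist_lt _ _
    calc _ ≤ ∫⁻ x in {x | d x < r₀ / 2 / 2}ᶜ,
            ENNReal.ofReal (max 1 (r₀ / 4)⁻¹ ^ (p + 1)) * F x ∂(volume.restrict Ω) := by
          refine setLIntegral_mono' hms.compl fun x hx => ?_
          rw [mem_compl_iff, mem_ofPred_eq, not_lt] at hx
          rw [mul_comm]
          exact mul_le_mul_left (ofReal_rpow_neg_le_of_le hp hε hε1 (by positivity)
            (by linarith)) _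
      _ ≤ ∫⁻ x, ENNReal.ofReal (max 1 (r₀ / 4)⁻¹ ^ (p + 1)) * F x :=
          lintegral_mono' (Measure.restrict_le_self.trans Measure.restrict_le_self) le_rfl
      _ = ENNReal.ofReal (max 1 (r₀ / 4)⁻¹ ^ (p + 1)) * ∫⁻ x, F x := lintegral_const_mul _ hFm
      _ ≤ ENNReal.ofReal (max 1 (r₀ / 4)⁻¹ ^ (p + 1)) *
            (ENNReal.ofReal (2 * R) ^ p * ∫⁻ x, G x) :=
          mul_le_mul_right (hf.lintegral_rpow_le_of_support_subset_ball hp hR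
            fun x hx => hf0 x fun h => hx (hΩR h)) _
      _ ≤ ENNReal.ofReal (max 1 (r₀ / 4)⁻¹ ^ (p + 1)) *
            (ENNReal.ofReal (2 * R) ^ p * (ENNReal.ofReal (max 1 (2 * R)) * I)) := by
          refine mul_le_mul_right (mul_le_mul_right ?_ _) _
          rw [← setLIntegral_enorm_fderiv_eq hp hsupp, hI,
            ← lintegral_const_mul' _ _ ENNReal.ofReal_ne_top]
          refine setLIntegral_mono' hopen.measurableSet fun x hx => ?_
          calc G x = G x * 1 := (mul_one _).symm
            _ ≤ G x * _ := mul_le_mul_right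
                (one_le_ofReal_mul_rpow_neg hε hε1 (hdpos x hx) (hdR x hx)) _
            _ = _ := by ring
      _ = B₂ * I := by rw [hB₂]; ring
  rw [← lintegral_add_compl _ (measurableSet_infDist_lt (frontier Ω) (r₀ / 2 / 2))]
  calc _ ≤ B₁ * ENNReal.ofReal ε⁻¹ * I + B₂ * I := add_le_add hnear hfar
    _ ≤ B₁ * ENNReal.ofReal ε⁻¹ * I + B₂ * ENNReal.ofReal ε⁻¹ * I :=
        add_le_add le_rfl (mul_le_mul_left (le_mul_of_one_le_right' hε') _)
    _ = _ := by ring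

end Hardy

lemma exists_lipschitzWith_max_rpow {a m : ℝ} (ha : 0 < a) (ha1 : a ≤ 1) (hm : 0 < m) :
    ∃ M : ℝ≥0, LipschitzWith M fun t : ℝ => max t m ^ a := by
  refine ⟨Real.toNNReal (a * m ^ (a - 1)), LipschitzWith.of_dist_le_mul fun s t => ?_⟩
  have hC : 0 ≤ a * m ^ (a - 1) := by positivity
  rw [Real.coe_toNNReal _ hC, dist_comm, Real.dist_eq, dist_comm, Real.dist_eq,
    ← Real.norm_eq_abs]
  have h := (convex_Ici m).norm_image_sub_le_of_norm_hasDerivWithin_le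
    (f := fun t : ℝ => t ^ a) (f' := fun t => a * t ^ (a - 1)) (C := a * m ^ (a - 1))
    (fun x hx => (Real.hasDerivAt_rpow_const (Or.inl (hm.trans_le hx).ne')).hasDerivWithinAt)
    (fun x hx => by
      have hx0 : 0 < x := hm.trans_le hx
      rw [Real.norm_of_nonneg (by positivity)]
      exact mul_le_mul_of_nonneg_left
        (Real.rpow_le_rpow_of_nonpos hm hx (by linarith)) ha.le)
    (le_max_right s m) (le_max_right t m)
  refine h.trans (mul_le_mul_of_nonneg_left ?_ hC)
  rw [Real.norm_eq_abs]
  exact abs_max_sub_max_le_abs t s m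

lemma exists_pos_le_one_mul_rpow_le (A : ℝ≥0) {p : ℝ} (hp : 1 < p) :
    ∃ ε : ℝ, 0 < ε ∧ ε ≤ 1 ∧
      (A : ℝ≥0∞) * ENNReal.ofReal ε⁻¹ * (2 ^ p * ENNReal.ofReal (ε / p) ^ p) ≤ 2⁻¹ := by
  have hp0 : 0 < p := by linarith
  set B : ℝ := 2 * (A + 1) * 2 ^ p with hB
  have hB1 : 1 ≤ B := by
    have h1 : (1 : ℝ) ≤ 2 ^ p := Real.one_le_rpow one_le_two hp0.le
    have h2 : (0 : ℝ) ≤ A := A.2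
    nlinarith
  have hB0 : 0 < B := by linarith
  refine ⟨B⁻¹ ^ (p - 1)⁻¹, by positivity,
    Real.rpow_le_one (by positivity) (inv_le_one_of_one_le₀ hB1)
    (inv_nonneg.2 (by linarith)), ?_⟩
  set ε := B⁻¹ ^ (p - 1)⁻¹ with hε
  have hε0 : 0 < ε := by positivity
  have hεp : ε ^ p = ε * B⁻¹ := by
    have : ε ^ (p - 1) = B⁻¹ := by
      rw [hε, ← Real.rpow_mul (by positivity), inv_mul_cancel₀ (by linarith), Real.rpow_one]
    rw [← this, Real.rpow_sub_one hε0.ne']; field_simp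
  have h2 : (2 : ℝ≥0∞) ^ p = ENNReal.ofReal (2 ^ p) := by
    rw [← ENNReal.ofReal_rpow_of_pos two_pos]; norm_num
  have h3 : ENNReal.ofReal (ε / p) ^ p ≤ ENNReal.ofReal (ε ^ p) := by
    rw [← ENNReal.ofReal_rpow_of_pos hε0]
    exact ENNReal.rpow_le_rpow (ENNReal.ofReal_le_ofReal (div_le_self hε0.le hp.le)) hp0.le
  calc _ ≤ (A : ℝ≥0∞) * ENNReal.ofReal ε⁻¹ * (2 ^ p * ENNReal.ofReal (ε ^ p)) :=
        mul_le_mul_right (mul_le_mul_right h3 _) _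
    _ = ENNReal.ofReal (A * ε⁻¹ * (2 ^ p * ε ^ p)) := by
        rw [h2, ENNReal.ofReal_mul (by positivity), ENNReal.ofReal_mul (by positivity),
          ENNReal.ofReal_mul (by positivity), ENNReal.ofReal_coe_nnreal]
    _ ≤ ENNReal.ofReal 2⁻¹ := by
        refine ENNReal.ofReal_le_ofReal ?_
        rw [hεp]
        have : (A : ℝ) * ε⁻¹ * (2 ^ p * (ε * B⁻¹)) = A * 2 ^ p / B := by field_simp
        rw [this, div_le_iff₀ hB0, hB]
        have h4 : (0 : ℝ) ≤ 2 ^ p := by positivity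
        nlinarith [A.2]
    _ = 2⁻¹ := by rw [ENNReal.ofReal_inv_of_pos two_pos, ENNReal.ofReal_ofNat]

section Hardy

variable {n : ℕ} {p : ℝ}

local notation "𝔼" => EuclideanSpace ℝ (Fin n)

lemma lintegral_enorm_rpow_lt_top {f : 𝔼 → ℝ} (hp : 1 < p) (hf : Continuous f)
    (hc : HasCompactSupport f) : ∫⁻ x, ‖f x‖ₑ ^ p < ⊤ := by
  have h := (hf.memLp_of_hasCompactSupport (p := ENNReal.ofReal p) (μ := volume) hc).2
  have := lintegral_rpow_enorm_lt_top_of_eLpNorm_lt_top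
    (by simpa using (by linarith : 0 < p)) ENNReal.ofReal_ne_top h
  rwa [ENNReal.toReal_ofReal (by linarith)] at this

/-- **Hardy's inequality** for domains with uniformly fat complement. -/
theorem exists_hardy (hn : 0 < n) (hp : 1 < p) {Ω : Set 𝔼} (hb : Bornology.IsBounded Ω)
    (hopen : IsOpen Ω) (hne : Ω.Nonempty) {c₀ r₀ : ℝ} (hc₀ : 0 < c₀) (hr₀ : 0 < r₀)
    (hfat : UniformlyFat n p c₀ r₀ Ωᶜ) :
    ∃ A : ℝ≥0, ∀ (f : 𝔼 → ℝ) (L : ℝ≥0), LipschitzWith L f → HasCompactSupport f →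
      tsupport f ⊆ Ω →
      ∫⁻ x in Ω, ‖f x‖ₑ ^ p * ENNReal.ofReal (infDist x (frontier Ω) ^ (-p)) ≤
        A * ∫⁻ x, ‖fderiv ℝ f x‖ₑ ^ p := by
  have hp0 : 0 < p := by linarith
  obtain ⟨A, hA⟩ := exists_weighted_hardy hn hp hb hopen hne hc₀ hr₀ hfat
  obtain ⟨ε, hε, hε1, hAε⟩ := exists_pos_le_one_mul_rpow_le A hp
  refine ⟨2 * (A * ε⁻¹.toNNReal * 2 ^ p), fun f L hf hc hsupp => ?_⟩
  rw [← setLIntegral_enorm_fderiv_eq hp hsupp]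
  set d : 𝔼 → ℝ := fun x => infDist x (frontier Ω) with hd
  have hdm : Measurable d := (continuous_infDist_pt _).measurable
  have hdL : LipschitzWith 1 d := lipschitz_infDist_pt _
  have hdpos : ∀ x ∈ Ω, 0 < d x := fun x hx => infDist_frontier_pos hn hb hopen hx
  obtain ⟨m', hm', hmd'⟩ := IsCompact.exists_forall_le' hc (f := d) hdL.continuous.continuousOn
    (a := 0) fun x hx => hdpos x (hsupp hx)
  obtain ⟨m, hm, hmm'⟩ := exists_between hm'
  have hmd : ∀ x ∈ tsupport f, m < d x := fun x hx => hmm'.trans_le (hmd' x hx)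
  set a := ε / p with ha
  have ha0 : 0 < a := by positivity
  have hap : a * p = ε := by rw [ha]; field_simp
  obtain ⟨M, hM⟩ := exists_lipschitzWith_max_rpow ha0
    ((div_le_self hε.le hp.le).trans hε1) hm
  set w : 𝔼 → ℝ := fun x => max (d x) m ^ a with hw
  have hwL : LipschitzWith (M * 1) w := hM.comp hdL
  have hwd : ∀ x, m ≤ d x → w x = d x ^ a := fun x hx => by
    simp only [hw, max_eq_left hx]
  set g : 𝔼 → ℝ := fun x => w x * f x with hg
  obtain ⟨D, hD⟩ := hc.exists_bound_of_continuous hf.continuous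
  obtain ⟨W, hW⟩ := IsCompact.exists_bound_of_continuousOn hc (f := w) hwL.continuous.continuousOn
  have hgL := LipschitzWith.mul_of_bounded (D := D.toNNReal) (A := W.toNNReal) hwL hf
    (fun x => (hD x).trans (Real.le_coe_toNNReal D))
    (fun x hx => (hW x (subset_tsupport f hx)).trans (Real.le_coe_toNNReal W))
  have hgs : tsupport g ⊆ tsupport f :=
    closure_mono fun x hx => right_ne_zero_of_mul hx
  have key := hA ε hε hε1 g _ hgL (hgs.trans hsupp)
  set H := ∫⁻ x in Ω, ‖f x‖ₑ ^ p * ENNReal.ofReal (d x ^ (-p)) with hH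
  set I := ∫⁻ x in Ω, ‖fderiv ℝ f x‖ₑ ^ p with hI
  have hfm : Measurable fun x => ‖f x‖ₑ ^ p := (hf.continuous.measurable.enorm).pow_const p
  have hgf : ∀ x ∉ tsupport f, ‖f x‖ₑ ^ p = 0 := fun x hx => by
    rw [image_eq_zero_of_notMem_tsupport hx, enorm_zero, ENNReal.zero_rpow_of_pos hp0]
  have hwε : ∀ x ∈ tsupport f, ‖w x‖ₑ ^ p = ENNReal.ofReal (d x ^ ε) := fun x hx => by
    have hx0 : 0 < d x := hm.trans (hmd x hx)
    rw [hwd x (hmd x hx).le, ← ofReal_norm_rpow hp, Real.norm_of_nonneg (by positivity),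
      ← Real.rpow_mul hx0.le, hap]
  have hleft : ∫⁻ x in Ω, ‖g x‖ₑ ^ p * ENNReal.ofReal (d x ^ (-p - ε)) = H := by
    refine lintegral_congr fun x => ?_
    simp only [hg, enorm_mul, ENNReal.mul_rpow_of_nonneg _ _ hp0.le]
    by_cases hx : x ∈ tsupport f
    · have hx0 : 0 < d x := hm.trans (hmd x hx)
      rw [hwε x hx, mul_assoc, mul_left_comm, ← ENNReal.ofReal_mul (by positivity),
        ← Real.rpow_add hx0]
      congr 3; ring
    · simp [hgf x hx]
  have hright : ∫⁻ x in Ω, ‖fderiv ℝ g x‖ₑ ^ p * ENNReal.ofReal (d x ^ (-ε)) ≤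
      2 ^ p * (I + ENNReal.ofReal a ^ p * H) := by
    rw [hI, hH, ← lintegral_const_mul' _ _ (ENNReal.rpow_ne_top_of_nonneg hp0.le ENNReal.ofReal_ne_top),
      ← lintegral_add_left (measurable_enorm_fderiv_rpow f p),
      ← lintegral_const_mul' _ _ (ENNReal.rpow_ne_top_of_nonneg hp0.le ENNReal.ofNat_ne_top)]
    refine lintegral_mono_ae (ae_restrict_of_ae ?_)
    filter_upwards [hf.ae_differentiableAt, hdL.ae_differentiableAt] with x hfx hdx
    by_cases hx : x ∈ tsupport f
    · have hx0 : 0 < d x := hm.trans (hmd x hx)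
      have hev : w =ᶠ[𝓝 x] fun y => d y ^ a := by
        filter_upwards [hdL.continuous.continuousAt.eventually (lt_mem_nhds (hmd x hx))] with y hy
        exact hwd y hy.le
      have hder : HasFDerivAt w ((a * d x ^ (a - 1)) • fderiv ℝ d x) x :=
        (hdx.hasFDerivAt.rpow_const (Or.inl hx0.ne')).congr_of_eventuallyEq hev
      have hdw : ‖fderiv ℝ w x‖ₑ ^ p ≤ ENNReal.ofReal a ^ p * ENNReal.ofReal (d x ^ (ε - p)) := by
        have h1 : ‖fderiv ℝ w x‖ₑ ≤ ENNReal.ofReal a * ENNReal.ofReal (d x ^ (a - 1)) := by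
          rw [hder.fderiv, enorm_smul, ← ENNReal.ofReal_mul ha0.le,
            Real.enorm_of_nonneg (by positivity)]
          exact mul_le_of_le_one_right' (by simpa using enorm_fderiv_le_of_lipschitz hdL x)
        calc _ ≤ (ENNReal.ofReal a * ENNReal.ofReal (d x ^ (a - 1))) ^ p :=
              ENNReal.rpow_le_rpow h1 hp0.le
          _ = _ := by
            rw [ENNReal.mul_rpow_of_nonneg _ _ hp0.le,
              ENNReal.ofReal_rpow_of_pos (p := p) (x := d x ^ (a - 1)) (by positivity),
              ← Real.rpow_mul hx0.le, sub_mul, hap, one_mul]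
      have e1 : ENNReal.ofReal (d x ^ ε) * ENNReal.ofReal (d x ^ (-ε)) = 1 := by
        rw [← ENNReal.ofReal_mul (by positivity), ← Real.rpow_add hx0]; simp
      have e2 : ENNReal.ofReal (d x ^ (ε - p)) * ENNReal.ofReal (d x ^ (-ε)) =
          ENNReal.ofReal (d x ^ (-p)) := by
        rw [← ENNReal.ofReal_mul (by positivity), ← Real.rpow_add hx0]; congr 2; ring
      calc _ ≤ 2 ^ p * (‖w x‖ₑ ^ p * ‖fderiv ℝ f x‖ₑ ^ p + ‖f x‖ₑ ^ p * ‖fderiv ℝ w x‖ₑ ^ p) *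
            ENNReal.ofReal (d x ^ (-ε)) :=
            mul_le_mul_left (enorm_fderiv_mul_rpow_le hder.differentiableAt hfx hp) _
        _ ≤ 2 ^ p * (ENNReal.ofReal (d x ^ ε) * ‖fderiv ℝ f x‖ₑ ^ p +
              ‖f x‖ₑ ^ p * (ENNReal.ofReal a ^ p * ENNReal.ofReal (d x ^ (ε - p)))) *
            ENNReal.ofReal (d x ^ (-ε)) := by
            rw [hwε x hx]
            exact mul_le_mul_left (mul_le_mul_right (add_le_add le_rfl
              (mul_le_mul_right hdw _)) _) _
        _ = 2 ^ p * ((ENNReal.ofReal (d x ^ ε) * ENNReal.ofReal (d x ^ (-ε))) *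
              ‖fderiv ℝ f x‖ₑ ^ p + ENNReal.ofReal a ^ p * (‖f x‖ₑ ^ p *
              (ENNReal.ofReal (d x ^ (ε - p)) * ENNReal.ofReal (d x ^ (-ε))))) := by ring
        _ = _ := by rw [e1, e2, one_mul]
    · rw [enorm_fderiv_rpow_eq_zero hp
        (fderiv_eq_zero_of_notMem_tsupport fun h => hx (hgs h)), zero_mul]
      exact zero_le
  have hHt : H ≠ ⊤ := by
    refine ne_top_of_le_ne_top (ENNReal.mul_ne_top
      (lintegral_enorm_rpow_lt_top hp hf.continuous hc).ne
      (ENNReal.ofReal_ne_top (r := m ^ (-p)))) ?_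
    rw [← lintegral_mul_const _ hfm]
    refine (setLIntegral_le_lintegral _ _).trans (lintegral_mono fun x => ?_)
    by_cases hx : x ∈ tsupport f
    · exact mul_le_mul_right (ENNReal.ofReal_le_ofReal
        (Real.rpow_le_rpow_of_nonpos hm (hmd x hx).le (by linarith))) _
    · simp [hgf x hx]
  rw [hleft] at key
  have h2 : H ≤ A * ENNReal.ofReal ε⁻¹ * 2 ^ p * I + 2⁻¹ * H :=
    calc H ≤ A * ENNReal.ofReal ε⁻¹ * (2 ^ p * (I + ENNReal.ofReal a ^ p * H)) :=
          key.trans (mul_le_mul_right hright _)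
      _ = A * ENNReal.ofReal ε⁻¹ * 2 ^ p * I +
          A * ENNReal.ofReal ε⁻¹ * (2 ^ p * ENNReal.ofReal a ^ p) * H := by ring
      _ ≤ _ := add_le_add le_rfl (mul_le_mul_left hAε _)
  have h3 : 2⁻¹ * H ≤ A * ENNReal.ofReal ε⁻¹ * 2 ^ p * I := by
    have h4 : 2⁻¹ * H + 2⁻¹ * H ≤ A * ENNReal.ofReal ε⁻¹ * 2 ^ p * I + 2⁻¹ * H := by
      rw [← add_mul, ENNReal.inv_two_add_inv_two, one_mul]; exact h2
    exact (ENNReal.add_le_add_iff_right (ENNReal.mul_ne_top (by simp) hHt)).1 h4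
  calc H = 2 * (2⁻¹ * H) := by
        rw [← mul_assoc, ENNReal.mul_inv_cancel two_ne_zero ENNReal.ofNat_ne_top, one_mul]
    _ ≤ 2 * (A * ENNReal.ofReal ε⁻¹ * 2 ^ p * I) := mul_le_mul_right h3 _
    _ = _ := by
        push_cast
        rw [ENNReal.coe_rpow_of_nonneg _ hp0.le, ENNReal.ofReal]
        push_cast
        ring

end Hardy

section Truncation

variable {n : ℕ} {p : ℝ}

local notation "𝔼" => EuclideanSpace ℝ (Fin n)

/-- The truncation of `|f|` between the levels `t / 2` and `t`, rescaled to take values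
in `[0, 1]`. -/
noncomputable def levelTruncation {X : Type*} (f : X → ℝ) (t : ℝ) (x : X) : ℝ :=
  max 0 (min 1 (2 / t * |f x| - 1))

lemma levelTruncation_lipschitz {X : Type*} [PseudoMetricSpace X] {f : X → ℝ} {L : ℝ≥0}
    (hf : LipschitzWith L f) {t : ℝ} (ht : 0 < t) :
    LipschitzWith (Real.toNNReal (2 / t) * L) (levelTruncation f t) := by
  have h : LipschitzWith (Real.toNNReal (2 / t) * L) fun x => 2 / t * |f x| - 1 := by
    refine LipschitzWith.of_dist_le_mul fun x y => ?_
    have h1 := hf.dist_le_mul x y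
    rw [Real.dist_eq] at h1 ⊢
    rw [NNReal.coe_mul, Real.coe_toNNReal _ (by positivity), sub_sub_sub_cancel_right, ← mul_sub,
      abs_mul, abs_of_pos (by positivity : 0 < 2 / t), mul_assoc]
    exact mul_le_mul_of_nonneg_left ((abs_abs_sub_abs_le_abs_sub _ _).trans h1) (by positivity)
  exact (h.const_min 1).const_max 0

lemma levelTruncation_nonneg {X : Type*} (f : X → ℝ) (t : ℝ) (x : X) :
    0 ≤ levelTruncation f t x := le_max_left _ _

lemma levelTruncation_le_one {X : Type*} (f : X → ℝ) (t : ℝ) (x : X) :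
    levelTruncation f t x ≤ 1 := max_le zero_le_one (min_le_left _ _)

lemma levelTruncation_eq_one {X : Type*} {f : X → ℝ} {t : ℝ} (ht : 0 < t) {x : X}
    (hx : t ≤ |f x|) : levelTruncation f t x = 1 := by
  have : 2 ≤ 2 / t * |f x| := by rw [div_mul_eq_mul_div, le_div_iff₀ ht]; linarith
  rw [levelTruncation, min_eq_left (by linarith), max_eq_right zero_le_one]

lemma levelTruncation_eq_zero {X : Type*} {f : X → ℝ} {t : ℝ} (ht : 0 < t) {x : X}
    (hx : |f x| ≤ t / 2) : levelTruncation f t x = 0 := by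
  have : 2 / t * |f x| ≤ 1 := by rw [div_mul_eq_mul_div, div_le_iff₀ ht]; linarith
  rw [levelTruncation, max_eq_left ((min_le_right _ _).trans (by linarith))]

lemma levelTruncation_of_mem {X : Type*} {f : X → ℝ} {t : ℝ} (ht : 0 < t) {x : X}
    (hx : t / 2 < |f x|) (hx' : |f x| < t) : levelTruncation f t x = 2 / t * |f x| - 1 := by
  have h1 : 1 ≤ 2 / t * |f x| := by rw [div_mul_eq_mul_div, le_div_iff₀ ht]; linarith
  have h2 : 2 / t * |f x| ≤ 2 := by rw [div_mul_eq_mul_div, div_le_iff₀ ht]; linarith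
  rw [levelTruncation, min_eq_right (by linarith), max_eq_right (by linarith)]

lemma tsupport_levelTruncation_subset {X : Type*} [TopologicalSpace X] (f : X → ℝ) {t : ℝ}
    (ht : 0 < t) : tsupport (levelTruncation f t) ⊆ tsupport f := by
  refine closure_mono fun x hx h0 => hx (levelTruncation_eq_zero ht ?_)
  rw [h0, abs_zero]; positivity

lemma enorm_fderiv_levelTruncation_le {E : Type*} [NormedAddCommGroup E] [NormedSpace ℝ E]
    {f : E → ℝ} {t : ℝ} (ht : 0 < t) {x : E} (hc : Continuous f) (hf : DifferentiableAt ℝ f x) :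
    ‖fderiv ℝ (levelTruncation f t) x‖ₑ ≤
      (Icc |f x| (2 * |f x|)).indicator (fun t => ENNReal.ofReal (2 / t) * ‖fderiv ℝ f x‖ₑ) t := by
  have hzero : fderiv ℝ (levelTruncation f t) x = 0 → ‖fderiv ℝ (levelTruncation f t) x‖ₑ ≤
      (Icc |f x| (2 * |f x|)).indicator
        (fun t => ENNReal.ofReal (2 / t) * ‖fderiv ℝ f x‖ₑ) t := by
    intro h
    rw [h, ← ofReal_norm, norm_zero, ENNReal.ofReal_zero]
    exact zero_le
  rcases le_or_gt |f x| (t / 2) with h | h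
  · refine hzero (IsLocalMin.fderiv_eq_zero (Eventually.of_forall fun y => ?_))
    rw [levelTruncation_eq_zero ht h]
    exact levelTruncation_nonneg f t y
  rcases le_or_gt t |f x| with h' | h'
  · refine hzero (IsLocalMax.fderiv_eq_zero (Eventually.of_forall fun y => ?_))
    rw [levelTruncation_eq_one ht h']
    exact levelTruncation_le_one f t y
  rw [indicator_of_mem (show t ∈ Icc |f x| (2 * |f x|) from ⟨h'.le, by linarith⟩)]
  have hf0 : f x ≠ 0 := fun h0 => by rw [h0, abs_zero] at h; linarith
  have hca : Continuous fun y => |f y| := hc.abs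
  have hev : levelTruncation f t =ᶠ[𝓝 x] fun y => 2 / t * |f y| - 1 := by
    filter_upwards [hca.continuousAt.eventually (lt_mem_nhds h),
      hca.continuousAt.eventually (gt_mem_nhds h')] with y hy hy'
    exact levelTruncation_of_mem ht hy hy'
  have hsgn : ∃ s : ℝ, |s| = 1 ∧ HasFDerivAt (fun y => |f y|) (s • fderiv ℝ f x) x := by
    rcases lt_or_gt_of_ne hf0 with h0 | h0
    · refine ⟨-1, by simp, ?_⟩
      simpa using hf.hasFDerivAt.abs_of_neg h0
    · refine ⟨1, by simp, ?_⟩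
      simpa using hf.hasFDerivAt.abs_of_pos h0
  obtain ⟨s, hs, hder⟩ := hsgn
  rw [(((hder.const_mul (2 / t)).sub_const 1).congr_of_eventuallyEq hev).fderiv, enorm_smul,
    enorm_smul, Real.enorm_of_nonneg (by positivity), Real.enorm_eq_ofReal_abs, hs,
    ENNReal.ofReal_one, one_mul]

/-- **Maz'ya's truncation argument**: the capacitary condition on the support of `f` yields the
strong type inequality for `f`. -/
lemma lintegral_rpow_le_of_forall_le_pCap (hp : 1 < p) {ν : Measure 𝔼} {Ω : Set 𝔼}
    {Q : ℝ≥0∞} {f : 𝔼 → ℝ} {L : ℝ≥0} (hf : LipschitzWith L f) (hc : HasCompactSupport f)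
    (hsupp : tsupport f ⊆ Ω)
    (hν : ∀ K : Set 𝔼, IsCompact K → K ⊆ tsupport f → ν K ≤ Q * ENNReal.ofReal (pCap n p K Ω)) :
    ∫⁻ x, ‖f x‖ₑ ^ p ∂ν ≤ ENNReal.ofReal p * 2 ^ p * Q * ∫⁻ x, ‖fderiv ℝ f x‖ₑ ^ p := by
  have hp0 : 0 < p := by linarith
  set K : ℝ → 𝔼 → ℝ≥0∞ := fun t x =>
    (Icc |f x| (2 * |f x|)).indicator (fun t => ENNReal.ofReal t⁻¹) t * ‖fderiv ℝ f x‖ₑ ^ p with hK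
  have hfa : Continuous fun x => |f x| := hf.continuous.abs
  have hKm : Measurable (Function.uncurry K) := by
    refine Measurable.mul ?_ ((measurable_enorm_fderiv_rpow f p).comp measurable_snd)
    have h1 : Measurable fun q : ℝ × 𝔼 => |f q.2| := hfa.measurable.comp measurable_snd
    have h2 : Measurable fun q : ℝ × 𝔼 => ENNReal.ofReal q.1⁻¹ := by fun_prop
    exact h2.indicator ((measurableSet_le h1 measurable_fst).inter
      (measurableSet_le measurable_fst (h1.const_mul 2)))
  have hcomp : ∀ t, 0 < t → IsCompact {x | t ≤ |f x|} ∧ {x | t ≤ |f x|} ⊆ tsupport f := by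
    intro t ht
    have hsub : {x | t ≤ |f x|} ⊆ tsupport f := fun x hx => subset_tsupport f fun h0 => by
      have hx' : t ≤ |f x| := hx
      rw [h0, abs_zero] at hx'; linarith
    exact ⟨IsCompact.of_isClosed_subset hc (isClosed_le continuous_const hfa) hsub, hsub⟩
  have hlevel : ∀ t, 0 < t → ν {x | t ≤ |f x|} * ENNReal.ofReal (t ^ (p - 1)) ≤
      2 ^ p * Q * ∫⁻ x, K t x := by
    intro t ht
    have hcap := ofReal_pCap_le (n := n) (K := {x | t ≤ |f x|}) (U := Ω) hp
      (levelTruncation_lipschitz hf ht)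
      (IsCompact.of_isClosed_subset hc (isClosed_tsupport _) (tsupport_levelTruncation_subset f ht))
      ((tsupport_levelTruncation_subset f ht).trans hsupp)
      fun x hx => (levelTruncation_eq_one ht hx).ge
    have hint : (∫⁻ x, ‖fderiv ℝ (levelTruncation f t) x‖ₑ ^ p) * ENNReal.ofReal (t ^ (p - 1)) ≤
        2 ^ p * ∫⁻ x, K t x := by
      rw [← lintegral_mul_const' _ _ ENNReal.ofReal_ne_top, ← lintegral_const_mul' _ _
        (ENNReal.rpow_ne_top_of_nonneg hp0.le ENNReal.ofNat_ne_top)]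
      refine lintegral_mono_ae ?_
      filter_upwards [hf.ae_differentiableAt] with x hx
      have h1 := ENNReal.rpow_le_rpow
        (enorm_fderiv_levelTruncation_le ht hf.continuous hx) hp0.le
      refine (mul_le_mul_left h1 _).trans ?_
      simp only [hK]
      by_cases hmem : t ∈ Icc |f x| (2 * |f x|)
      · rw [indicator_of_mem hmem, indicator_of_mem hmem,
          ENNReal.mul_rpow_of_nonneg _ _ hp0.le, div_eq_mul_inv, ENNReal.ofReal_mul two_pos.le,
          ENNReal.mul_rpow_of_nonneg _ _ hp0.le, ENNReal.ofReal_ofNat]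
        have h2 : ENNReal.ofReal t⁻¹ ^ p * ENNReal.ofReal (t ^ (p - 1)) = ENNReal.ofReal t⁻¹ := by
          rw [ENNReal.ofReal_rpow_of_pos (by positivity), ← ENNReal.ofReal_mul (by positivity),
            Real.inv_rpow ht.le, Real.rpow_sub_one ht.ne']
          congr 1
          field_simp
        refine le_of_eq ?_
        calc _ = 2 ^ p * ((ENNReal.ofReal t⁻¹ ^ p * ENNReal.ofReal (t ^ (p - 1))) *
              ‖fderiv ℝ f x‖ₑ ^ p) := by ring
          _ = _ := by rw [h2]
      · rw [indicator_of_notMem hmem, ENNReal.zero_rpow_of_pos hp0, zero_mul]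
        exact zero_le
    calc _ ≤ Q * (∫⁻ x, ‖fderiv ℝ (levelTruncation f t) x‖ₑ ^ p) * ENNReal.ofReal (t ^ (p - 1)) :=
          mul_le_mul_left ((hν _ (hcomp t ht).1 (hcomp t ht).2).trans (mul_le_mul_right hcap _)) _
      _ ≤ Q * (2 ^ p * ∫⁻ x, K t x) := by
          rw [mul_assoc]; exact mul_le_mul_right hint _
      _ = _ := by ring
  have hinner : ∀ x, ∫⁻ t in Ioi 0, K t x ≤ ‖fderiv ℝ f x‖ₑ ^ p := by
    intro x
    have hm : Measurable fun t : ℝ =>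
        (Icc |f x| (2 * |f x|)).indicator (fun t => ENNReal.ofReal t⁻¹) t :=
      (by fun_prop : Measurable fun t : ℝ => ENNReal.ofReal t⁻¹).indicator measurableSet_Icc
    simp only [hK]
    rw [lintegral_mul_const _ hm]
    refine mul_le_of_le_one_left' ?_
    calc _ ≤ ∫⁻ t, (Icc |f x| (2 * |f x|)).indicator (fun t => ENNReal.ofReal t⁻¹) t :=
          setLIntegral_le_lintegral _ _
      _ = ∫⁻ t in Icc |f x| (2 * |f x|), ENNReal.ofReal t⁻¹ := lintegral_indicator measurableSet_Icc _
      _ ≤ ∫⁻ t in Icc |f x| (2 * |f x|), ENNReal.ofReal |f x|⁻¹ := by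
          rcases (abs_nonneg (f x)).eq_or_lt with h0 | h0
          · rw [← h0]; simp
          · exact setLIntegral_mono' measurableSet_Icc fun t ht =>
              ENNReal.ofReal_le_ofReal (inv_anti₀ h0 ht.1)
      _ = ENNReal.ofReal (|f x|⁻¹ * |f x|) := by
          rw [lintegral_const, Measure.restrict_apply_univ, Real.volume_Icc,
            ENNReal.ofReal_mul (by positivity)]
          congr 2; ring
      _ ≤ 1 := by
          rw [ENNReal.ofReal_le_one]; exact inv_mul_le_one
  calc ∫⁻ x, ‖f x‖ₑ ^ p ∂ν = ∫⁻ x, ENNReal.ofReal (|f x| ^ p) ∂ν := by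
        refine lintegral_congr fun x => ?_
        rw [← ofReal_norm_rpow hp, Real.norm_eq_abs]
    _ = ENNReal.ofReal p * ∫⁻ t in Ioi 0, ν {x | t ≤ |f x|} * ENNReal.ofReal (t ^ (p - 1)) :=
        lintegral_rpow_eq_lintegral_meas_le_mul ν (Eventually.of_forall fun x => abs_nonneg _)
          hfa.measurable.aemeasurable hp0
    _ ≤ ENNReal.ofReal p * ∫⁻ t in Ioi 0, 2 ^ p * Q * ∫⁻ x, K t x :=
        mul_le_mul_right (setLIntegral_mono' measurableSet_Ioi hlevel) _
    _ = ENNReal.ofReal p * (2 ^ p * Q * ∫⁻ x, ∫⁻ t in Ioi 0, K t x) := by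
        rw [lintegral_const_mul, lintegral_lintegral_swap hKm.aemeasurable]
        exact hKm.lintegral_prod_right'
    _ ≤ ENNReal.ofReal p * (2 ^ p * Q * ∫⁻ x, ‖fderiv ℝ f x‖ₑ ^ p) :=
        mul_le_mul_right (mul_le_mul_right (lintegral_mono hinner) _) _
    _ = _ := by ring

end Truncation

section Whitney

variable {n : ℕ} {p : ℝ}

local notation "𝔼" => EuclideanSpace ℝ (Fin n)

lemma lintegral_le_of_kernels {X Y : Type*} [MeasurableSpace X] [MeasurableSpace Y]
    {μ : Measure X} {ν ρ : Measure Y} [SFinite μ] [SFinite ν] [SFinite ρ] {k l : X → Y → ℝ≥0∞}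
    (hk : Measurable (Function.uncurry k)) (hl : Measurable (Function.uncurry l))
    {F h : Y → ℝ≥0∞} (hF : Measurable F) (hh : Measurable h) {Ω : Set Y} (hΩ : MeasurableSet Ω)
    {a b C : ℝ≥0∞} (hlow : ∀ y ∈ Ω, a ≤ ∫⁻ x, k x y ∂μ)
    (hup : ∀ y, ∫⁻ x, l x y ∂μ ≤ Ω.indicator (fun _ => b) y)
    (hloc : ∀ᵐ x ∂μ, ∫⁻ y, k x y * F y ∂ν ≤ C * ∫⁻ y, l x y * h y ∂ρ) :
    a * ∫⁻ y in Ω, F y ∂ν ≤ b * (C * ∫⁻ y in Ω, h y ∂ρ) := by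
  have hkF : Measurable (Function.uncurry fun x y => k x y * F y) :=
    hk.mul (hF.comp measurable_snd)
  have hlh : Measurable (Function.uncurry fun x y => l x y * h y) :=
    hl.mul (hh.comp measurable_snd)
  have h1 : a * ∫⁻ y in Ω, F y ∂ν ≤ ∫⁻ y, (∫⁻ x, k x y ∂μ) * F y ∂ν := by
    rw [← lintegral_const_mul _ hF]
    exact (setLIntegral_mono' hΩ fun y hy => mul_le_mul_left (hlow y hy) _).trans
      (setLIntegral_le_lintegral _ _)
  have h2 : ∫⁻ y, (∫⁻ x, k x y ∂μ) * F y ∂ν = ∫⁻ x, (∫⁻ y, k x y * F y ∂ν) ∂μ := by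
    rw [lintegral_lintegral_swap hkF.aemeasurable]
    exact lintegral_congr fun y => (lintegral_mul_const _ (hk.comp measurable_prodMk_right)).symm
  have h3 : ∫⁻ x, (∫⁻ y, l x y * h y ∂ρ) ∂μ = ∫⁻ y, (∫⁻ x, l x y ∂μ) * h y ∂ρ := by
    rw [lintegral_lintegral_swap hlh.aemeasurable]
    exact lintegral_congr fun y => lintegral_mul_const _ (hl.comp measurable_prodMk_right)
  have h4 : ∫⁻ y, (∫⁻ x, l x y ∂μ) * h y ∂ρ ≤ b * ∫⁻ y in Ω, h y ∂ρ := by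
    rw [← lintegral_const_mul _ hh, ← lintegral_indicator hΩ]
    refine lintegral_mono fun y => (mul_le_mul_left (hup y) _).trans (le_of_eq ?_)
    by_cases hy : y ∈ Ω <;> simp [hy]
  have h5 : ∫⁻ x, (C * ∫⁻ y, l x y * h y ∂ρ) ∂μ = C * ∫⁻ x, (∫⁻ y, l x y * h y ∂ρ) ∂μ :=
    lintegral_const_mul _ (hlh.lintegral_prod_right' (ν := ρ))
  calc _ ≤ C * ∫⁻ x, (∫⁻ y, l x y * h y ∂ρ) ∂μ := by
        rw [← h5]
        exact h1.trans (h2.le.trans (lintegral_mono_ae hloc))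
    _ ≤ C * (b * ∫⁻ y in Ω, h y ∂ρ) := by
        rw [h3]
        exact mul_le_mul_right h4 _
    _ = _ := mul_left_comm _ _ _

/-- Integrating an inequality on Whitney type balls with respect to the centre. -/
lemma lintegral_le_of_whitney_balls (hn : 0 < n) {Ω : Set 𝔼} (hb : Bornology.IsBounded Ω)
    (hopen : IsOpen Ω) {ν : Measure 𝔼} [SFinite ν] {F h : 𝔼 → ℝ≥0∞} (hF : Measurable F)
    (hh : Measurable h) {C : ℝ≥0∞}
    (hloc : ∀ x ∈ Ω, ∫⁻ y in ball x (infDist x (frontier Ω) / 300), F y ∂ν ≤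
      C * ∫⁻ y in ball x (infDist x (frontier Ω) / 100), h y) :
    ∫⁻ y in Ω, F y ∂ν ≤ 800 ^ n * C * ∫⁻ y in Ω, h y := by
  have : Nonempty (Fin n) := ⟨⟨0, hn⟩⟩
  set d : 𝔼 → ℝ := fun x => infDist x (frontier Ω) with hd
  have hdc : Continuous d := continuous_infDist_pt _
  have hdL : ∀ x y, d x ≤ d y + dist x y := fun x y => infDist_le_infDist_add_dist
  have hdpos : ∀ x ∈ Ω, 0 < d x := fun x hx => infDist_frontier_pos hn hb hopen hx
  set v := volume (ball (0 : 𝔼) 1) with hv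
  have hv0 : v ≠ 0 := (measure_ball_pos _ _ one_pos).ne'
  have hvt : v ≠ ⊤ := measure_ball_lt_top.ne
  have hball : ∀ (y : 𝔼) (r : ℝ), 0 < r → volume (ball y r) = ENNReal.ofReal r ^ n * v :=
    fun y r hr => by
      have := volume_ball_mul_radius hn y (0 : 𝔼) hr.le zero_le_one
      rwa [mul_one] at this
  set W : 𝔼 → ℝ≥0∞ := fun x => ENNReal.ofReal ((d x)⁻¹ ^ n) with hW
  have hWm : Measurable W := by
    have := hdc.measurable
    fun_prop
  have hTm : ∀ a : ℝ, MeasurableSet {q : 𝔼 × 𝔼 | dist q.2 q.1 < d q.1 / a} := fun a =>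
    measurableSet_lt (measurable_snd.dist measurable_fst)
      ((hdc.measurable.comp measurable_fst).div_const a)
  set k : ℝ → 𝔼 → 𝔼 → ℝ≥0∞ := fun a x y =>
    {q : 𝔼 × 𝔼 | dist q.2 q.1 < d q.1 / a}.indicator (fun q => W q.1) (x, y) with hk
  have hkm : ∀ a, Measurable (Function.uncurry (k a)) := fun a =>
    (hWm.comp measurable_fst).indicator (hTm a)
  have hslice : ∀ (a : ℝ) (μ : Measure 𝔼) (H : 𝔼 → ℝ≥0∞) (_ : Measurable H) (x : 𝔼),
      ∫⁻ y, k a x y * H y ∂μ = W x * ∫⁻ y in ball x (d x / a), H y ∂μ := by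
    intro a μ H hH x
    rw [← lintegral_const_mul _ hH, ← lintegral_indicator measurableSet_ball]
    congr with y
    by_cases hy : dist y x < d x / a
    · rw [indicator_of_mem (show y ∈ ball x (d x / a) from hy)]
      simp only [hk]
      rw [indicator_of_mem (show (x, y) ∈ {q : 𝔼 × 𝔼 | dist q.2 q.1 < d q.1 / a} from hy)]
    · rw [indicator_of_notMem (show y ∉ ball x (d x / a) from hy)]
      simp only [hk]
      rw [indicator_of_notMem
        (show (x, y) ∉ {q : 𝔼 × 𝔼 | dist q.2 q.1 < d q.1 / a} from hy), zero_mul]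
  have hlow : ∀ y ∈ Ω, ENNReal.ofReal (800⁻¹ ^ n) * v ≤ ∫⁻ x in Ω, k 300 x y := by
    intro y hy
    have hy0 := hdpos y hy
    calc _ = ENNReal.ofReal ((2 * d y)⁻¹ ^ n) * volume (ball y (d y / 400)) := by
          rw [hball y _ (by positivity), ← ENNReal.ofReal_pow (by positivity), ← mul_assoc,
            ← ENNReal.ofReal_mul (by positivity), ← mul_pow]
          congr 3
          field_simp
          norm_num
      _ = ∫⁻ x in ball y (d y / 400), ENNReal.ofReal ((2 * d y)⁻¹ ^ n) := by
          rw [lintegral_const, Measure.restrict_apply_univ]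
      _ ≤ ∫⁻ x in ball y (d y / 400), k 300 x y := by
          refine setLIntegral_mono' measurableSet_ball fun x hx => ?_
          rw [mem_ball] at hx
          have h1 := hdL x y
          have h2 := hdL y x
          rw [dist_comm] at h2
          have hx0 : 0 < d x := by linarith
          simp only [hk]
          rw [indicator_of_mem (show (x, y) ∈ {q : 𝔼 × 𝔼 | dist q.2 q.1 < d q.1 / 300} by
            rw [mem_ofPred_eq, dist_comm]; linarith)]
          refine ENNReal.ofReal_le_ofReal (pow_le_pow_left₀ (by positivity) ?_ _)
          exact inv_anti₀ hx0 (by linarith)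
      _ ≤ _ := lintegral_mono_set fun x hx =>
          ball_infDist_frontier_subset hopen hy (ball_subset_ball (by linarith) hx)
  have hup : ∀ y, ∫⁻ x in Ω, k 100 x y ≤ Ω.indicator (fun _ => v) y := by
    intro y
    by_cases hy : y ∈ Ω
    · have hy0 := hdpos y hy
      rw [indicator_of_mem hy]
      calc ∫⁻ x in Ω, k 100 x y ≤ ∫⁻ x in Ω, (ball y (d y / 50)).indicator
            (fun _ => ENNReal.ofReal ((d y / 2)⁻¹ ^ n)) x := by
            refine setLIntegral_mono' hopen.measurableSet fun x hx => ?_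
            simp only [hk]
            by_cases hxy : dist y x < d x / 100
            · have h1 := hdL x y
              have h2 := hdL y x
              rw [dist_comm x y] at h1
              have hx0 := hdpos x hx
              rw [indicator_of_mem
                (show (x, y) ∈ {q : 𝔼 × 𝔼 | dist q.2 q.1 < d q.1 / 100} from hxy),
                indicator_of_mem (show x ∈ ball y (d y / 50) by
                  rw [mem_ball, dist_comm]; linarith)]
              refine ENNReal.ofReal_le_ofReal (pow_le_pow_left₀ (by positivity) ?_ _)
              exact inv_anti₀ (by positivity) (by linarith)
            · rw [indicator_of_notMem
                (show (x, y) ∉ {q : 𝔼 × 𝔼 | dist q.2 q.1 < d q.1 / 100} from hxy)]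
              exact zero_le
        _ ≤ ∫⁻ x, (ball y (d y / 50)).indicator
              (fun _ => ENNReal.ofReal ((d y / 2)⁻¹ ^ n)) x := setLIntegral_le_lintegral _ _
        _ = ENNReal.ofReal (25⁻¹ ^ n) * v := by
            rw [lintegral_indicator measurableSet_ball, lintegral_const,
              Measure.restrict_apply_univ, hball y _ (by positivity),
              ← ENNReal.ofReal_pow (by positivity), ← mul_assoc,
              ← ENNReal.ofReal_mul (by positivity), ← mul_pow]
            congr 3
            field_simp
            norm_num
        _ ≤ v := mul_le_of_le_one_left' (ENNReal.ofReal_le_one.2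
            (pow_le_one₀ (by norm_num) (by norm_num)))
    · rw [indicator_of_notMem hy, nonpos_iff_eq_zero]
      refine (setLIntegral_congr_fun hopen.measurableSet fun x hx => ?_).trans lintegral_zero
      simp only [hk]
      refine indicator_of_notMem (fun hxy => hy ?_) _
      exact ball_infDist_frontier_subset hopen hx
        (ball_subset_ball (by have := hdpos x hx; linarith) (mem_ball.2 hxy))
  have key : ENNReal.ofReal (800⁻¹ ^ n) * v * ∫⁻ y in Ω, F y ∂ν ≤ v * (C * ∫⁻ y in Ω, h y) := by
    refine lintegral_le_of_kernels (μ := volume.restrict Ω) (hkm 300) (hkm 100) hF hh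
      hopen.measurableSet hlow hup ((ae_restrict_iff' hopen.measurableSet).2
        (Eventually.of_forall fun x hx => ?_))
    rw [hslice _ _ _ hF, hslice _ _ _ hh, mul_left_comm]
    exact mul_le_mul_right (hloc x hx) _
  have h8 : (800 : ℝ≥0∞) ^ n * ENNReal.ofReal (800⁻¹ ^ n) = 1 := by
    rw [ENNReal.ofReal_pow (by positivity), ← mul_pow, ENNReal.ofReal_inv_of_pos (by norm_num),
      ENNReal.ofReal_ofNat, ENNReal.mul_inv_cancel (by norm_num) ENNReal.ofNat_ne_top, one_pow]
  refine (ENNReal.mul_le_mul_iff_right hv0 hvt).1 ?_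
  calc v * ∫⁻ y in Ω, F y ∂ν
      = 800 ^ n * (ENNReal.ofReal (800⁻¹ ^ n) * v * ∫⁻ y in Ω, F y ∂ν) := by
        rw [← mul_assoc, ← mul_assoc, h8, one_mul]
    _ ≤ 800 ^ n * (v * (C * ∫⁻ y in Ω, h y)) := mul_le_mul_right key _
    _ = _ := by ring

end Whitney

section Trace

variable {n : ℕ} {p : ℝ}

local notation "𝔼" => EuclideanSpace ℝ (Fin n)

lemma ofReal_two_div_rpow_le {d : 𝔼 → ℝ} (hdL : ∀ x y, d x ≤ d y + dist x y) (hp : 1 < p)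
    {x y : 𝔼} (hx : 0 < d x) (hy : dist y x < d x / 100) :
    ENNReal.ofReal (2 / (d x / 300)) ^ p ≤
      ENNReal.ofReal 1200 ^ p * ENNReal.ofReal (d y ^ (-p)) := by
  have h1 := hdL y x
  have h2 := hdL x y
  rw [dist_comm] at h2
  have hy0 : 0 < d y := by linarith
  have hp0 : 0 ≤ p := by linarith
  rw [Real.rpow_neg hy0.le, ← Real.inv_rpow hy0.le,
    ← ENNReal.ofReal_rpow_of_pos (by positivity), ← ENNReal.mul_rpow_of_nonneg _ _ hp0,
    ← ENNReal.ofReal_mul (by norm_num)]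
  refine ENNReal.rpow_le_rpow (ENNReal.ofReal_le_ofReal ?_) hp0
  rw [div_le_iff₀ (by positivity), ← div_eq_mul_inv, div_mul_eq_mul_div, le_div_iff₀ hy0]
  linarith

/-- The strong type inequality on a Whitney type ball. -/
lemma lintegral_ball_rpow_le_of_forall_le_pCap (hn : 0 < n) (hp : 1 < p) {Ω : Set 𝔼}
    (hb : Bornology.IsBounded Ω) (hopen : IsOpen Ω) {ν : Measure 𝔼} {Q : ℝ≥0∞} {x : 𝔼}
    (hx : x ∈ Ω)
    (hν : ∀ K : Set 𝔼, IsCompact K → K ⊆ ball x (infDist x (frontier Ω) / 100) →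
      ν K ≤ Q * ENNReal.ofReal (pCap n p K Ω))
    {f : 𝔼 → ℝ} {L : ℝ≥0} (hf : LipschitzWith L f) (hc : HasCompactSupport f) :
    ∫⁻ y in ball x (infDist x (frontier Ω) / 300), ‖f y‖ₑ ^ p ∂ν ≤
      ENNReal.ofReal p * 2 ^ p * Q * 2 ^ p *
        ∫⁻ y in ball x (infDist x (frontier Ω) / 100),
          (ENNReal.ofReal 1200 ^ p *
            (‖f y‖ₑ ^ p * ENNReal.ofReal (infDist y (frontier Ω) ^ (-p))) +
            ‖fderiv ℝ f y‖ₑ ^ p) := by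
  have hp0 : 0 < p := by linarith
  set d : 𝔼 → ℝ := fun x => infDist x (frontier Ω) with hd
  have hdL : ∀ x y, d x ≤ d y + dist x y := fun x y => infDist_le_infDist_add_dist
  have hx0 : 0 < d x := infDist_frontier_pos hn hb hopen hx
  set r := d x / 300 with hr
  have hr0 : 0 < r := by positivity
  set η := radialCutoff x r with hη
  obtain ⟨D, hD⟩ := hc.exists_bound_of_continuous hf.continuous
  set g : 𝔼 → ℝ := fun y => f y * η y with hg
  have hηL := radialCutoff_lipschitz x hr0
  have hgL := LipschitzWith.mul_of_bounded (D := 1) (A := D.toNNReal) hf hηL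
    (fun y => abs_radialCutoff_le_one x r y) (fun y _ => (hD y).trans (Real.le_coe_toNNReal D))
  have hgη : tsupport g ⊆ tsupport η := closure_mono fun y hy => right_ne_zero_of_mul hy
  have hgs : tsupport g ⊆ ball x (d x / 100) :=
    (hgη.trans (tsupport_radialCutoff_subset x hr0)).trans
      (closedBall_subset_ball (by rw [hr]; linarith))
  have hgc : HasCompactSupport g := hc.mul_right
  have hball : ball x (d x / 100) ⊆ Ω :=
    (ball_subset_ball (by linarith)).trans (ball_infDist_frontier_subset hopen hx)
  have key := lintegral_rpow_le_of_forall_le_pCap hp hgL hgc (hgs.trans hball)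
    fun K hK hKs => hν K hK (hKs.trans hgs)
  calc ∫⁻ y in ball x r, ‖f y‖ₑ ^ p ∂ν = ∫⁻ y in ball x r, ‖g y‖ₑ ^ p ∂ν := by
        refine setLIntegral_congr_fun measurableSet_ball fun y hy => ?_
        simp only [hg, hη]
        rw [radialCutoff_eq_one hr0 (mem_ball.1 hy).le, mul_one]
    _ ≤ ∫⁻ y, ‖g y‖ₑ ^ p ∂ν := setLIntegral_le_lintegral _ _
    _ ≤ ENNReal.ofReal p * 2 ^ p * Q * ∫⁻ y, ‖fderiv ℝ g y‖ₑ ^ p := key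
    _ = ENNReal.ofReal p * 2 ^ p * Q * ∫⁻ y in ball x (d x / 100), ‖fderiv ℝ g y‖ₑ ^ p := by
        rw [setLIntegral_enorm_fderiv_eq hp hgs]
    _ ≤ ENNReal.ofReal p * 2 ^ p * Q * ∫⁻ y in ball x (d x / 100), 2 ^ p *
          (ENNReal.ofReal 1200 ^ p * (‖f y‖ₑ ^ p * ENNReal.ofReal (d y ^ (-p))) +
            ‖fderiv ℝ f y‖ₑ ^ p) := by
        refine mul_le_mul_right (lintegral_mono_ae ?_) _
        filter_upwards [ae_restrict_mem measurableSet_ball,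
          ae_restrict_of_ae hf.ae_differentiableAt,
          ae_restrict_of_ae hηL.ae_differentiableAt] with y hy hfy hηy
        refine (enorm_fderiv_mul_rpow_le hfy hηy hp).trans
          (mul_le_mul_right (add_le_add ?_ ?_) _)
        · rw [mul_left_comm]
          refine mul_le_mul_right ?_ _
          exact (ENNReal.rpow_le_rpow (enorm_fderiv_le_of_lipschitz hηL y) hp0.le).trans
            (ofReal_two_div_rpow_le hdL hp hx0 hy)
        · refine mul_le_of_le_one_left' (ENNReal.rpow_le_one ?_ hp0.le)
          rw [Real.enorm_eq_ofReal_abs, ENNReal.ofReal_le_one]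
          exact abs_radialCutoff_le_one x r y
    _ = _ := by
        rw [lintegral_const_mul' _ _ (ENNReal.rpow_ne_top_of_nonneg hp0.le ENNReal.ofNat_ne_top)]
        ring

/-- The trace inequality for Lipschitz functions, for a measure subject to the localized
capacitary condition. -/
theorem exists_trace_inequality (hn : 0 < n) (hp : 1 < p) {Ω : Set 𝔼}
    (hb : Bornology.IsBounded Ω) (hopen : IsOpen Ω) (hne : Ω.Nonempty) {c₀ r₀ : ℝ} (hc₀ : 0 < c₀)
    (hr₀ : 0 < r₀) (hfat : UniformlyFat n p c₀ r₀ Ωᶜ) {ν : Measure 𝔼} [SFinite ν] {Q : ℝ≥0}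
    (hν : ∀ x ∈ Ω, ∀ K : Set 𝔼, IsCompact K → K ⊆ ball x (infDist x (frontier Ω) / 100) →
      ν K ≤ Q * ENNReal.ofReal (pCap n p K Ω)) :
    ∃ C : ℝ≥0, ∀ (f : 𝔼 → ℝ) (L : ℝ≥0), LipschitzWith L f → HasCompactSupport f →
      tsupport f ⊆ Ω →
      ∫⁻ x in Ω, ‖f x‖ₑ ^ p ∂ν ≤ C * ∫⁻ x, ‖fderiv ℝ f x‖ₑ ^ p := by
  have hp0 : 0 < p := by linarith
  obtain ⟨A, hA⟩ := exists_hardy hn hp hb hopen hne hc₀ hr₀ hfat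
  set C₁ : ℝ≥0∞ := ENNReal.ofReal p * 2 ^ p * Q * 2 ^ p with hC₁
  set C : ℝ≥0∞ := 800 ^ n * C₁ * (ENNReal.ofReal 1200 ^ p * A + 1) with hC
  have hCt : C ≠ ⊤ := by
    have h2 : (2 : ℝ≥0∞) ^ p ≠ ⊤ := ENNReal.rpow_ne_top_of_nonneg hp0.le ENNReal.ofNat_ne_top
    have h3 : ENNReal.ofReal 1200 ^ p ≠ ⊤ :=
      ENNReal.rpow_ne_top_of_nonneg hp0.le ENNReal.ofReal_ne_top
    have h4 : C₁ ≠ ⊤ := ENNReal.mul_ne_top (ENNReal.mul_ne_top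
      (ENNReal.mul_ne_top ENNReal.ofReal_ne_top h2) ENNReal.coe_ne_top) h2
    exact ENNReal.mul_ne_top (ENNReal.mul_ne_top (ENNReal.pow_ne_top ENNReal.ofNat_ne_top) h4)
      (ENNReal.add_ne_top.2 ⟨ENNReal.mul_ne_top h3 ENNReal.coe_ne_top, ENNReal.one_ne_top⟩)
  refine ⟨C.toNNReal, fun f L hf hc hsupp => ?_⟩
  rw [ENNReal.coe_toNNReal hCt]
  have hfm : Measurable fun x => ‖f x‖ₑ ^ p := (hf.continuous.measurable.enorm).pow_const p
  have hdm : Measurable fun x : 𝔼 => infDist x (frontier Ω) :=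
    (continuous_infDist_pt _).measurable
  have hwm : Measurable fun y => ENNReal.ofReal 1200 ^ p *
      (‖f y‖ₑ ^ p * ENNReal.ofReal (infDist y (frontier Ω) ^ (-p))) :=
    (hfm.mul (by fun_prop)).const_mul _
  refine (lintegral_le_of_whitney_balls hn hb hopen hfm
    (hwm.add (measurable_enorm_fderiv_rpow f p)) fun x hx =>
      lintegral_ball_rpow_le_of_forall_le_pCap hn hp hb hopen hx (hν x hx) hf hc).trans ?_
  rw [hC, mul_assoc (800 ^ n * C₁)]
  refine mul_le_mul_right ?_ _
  simp only [Pi.add_apply]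
  rw [lintegral_add_left hwm, setLIntegral_enorm_fderiv_eq hp hsupp, add_mul, one_mul,
    lintegral_const_mul' _ _ (ENNReal.rpow_ne_top_of_nonneg hp0.le ENNReal.ofReal_ne_top), mul_assoc]
  exact add_le_add (mul_le_mul_right (hA f L hf hc hsupp) _) le_rfl

end Trace

section Mollification

variable {n : ℕ} {p : ℝ}

local notation "𝔼" => EuclideanSpace ℝ (Fin n)

/-- Averaging translates of a Lipschitz function over an absolutely continuous probability
measure does not increase the `p`-energy. -/
lemma LipschitzWith.lintegral_fderiv_average_le (hp : 1 < p) {φ : 𝔼 → ℝ} {L : ℝ≥0}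
    (hL : LipschitzWith L φ) (hc : HasCompactSupport φ) (ν : Measure 𝔼) [IsProbabilityMeasure ν]
    (hν : ν ≪ volume) :
    ∫⁻ x, ‖fderiv ℝ (fun x => ∫ t, φ (x - t) ∂ν) x‖ₑ ^ p ≤ ∫⁻ x, ‖fderiv ℝ φ x‖ₑ ^ p := by
  have hmeas : Measurable fun q : 𝔼 × 𝔼 => ‖fderiv ℝ φ (q.1 - q.2)‖ₑ ^ p :=
    (measurable_enorm_fderiv_rpow φ p).comp (measurable_fst.sub measurable_snd)
  have hderiv : ∀ x, HasFDerivAt (fun x => ∫ t, φ (x - t) ∂ν) (∫ t, fderiv ℝ φ (x - t) ∂ν) x := by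
    intro x
    have hcont : ∀ y, Continuous fun t => φ (y - t) := fun y =>
      hL.continuous.comp (continuous_const.sub continuous_id)
    obtain ⟨B, hB⟩ := hL.continuous.bounded_above_of_compact_support hc
    refine (hasFDerivAt_integral_of_dominated_loc_of_lip (bound := fun _ => (L : ℝ))
      (F := fun y t => φ (y - t)) univ_mem
      (Eventually.of_forall fun y => (hcont y).aestronglyMeasurable)
      (Integrable.of_bound (hcont x).aestronglyMeasurable B (Eventually.of_forall fun t => hB _))
      ((measurable_fderiv ℝ φ).comp (measurable_const.sub measurable_id)).aestronglyMeasurable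
      (Eventually.of_forall fun t => ?_) (integrable_const _) ?_).2
    · refine LipschitzWith.lipschitzOnWith (LipschitzWith.of_dist_le_mul fun y z => ?_)
      have := hL.dist_le_mul (y - t) (z - t)
      rw [dist_sub_right] at this
      simpa using this
    · have h1 : ∀ᵐ t ∂(volume : Measure 𝔼), DifferentiableAt ℝ φ (x - t) :=
        (quasiMeasurePreserving_sub_left_of_right_invariant volume x).ae hL.ae_differentiableAt
      filter_upwards [hν.ae_le h1] with t ht
      have h2 := ht.hasFDerivAt.comp x ((hasFDerivAt_id x).sub_const t)
      simpa [Function.comp_def] using h2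
  calc ∫⁻ x, ‖fderiv ℝ (fun x => ∫ t, φ (x - t) ∂ν) x‖ₑ ^ p
      ≤ ∫⁻ x, (∫⁻ t, ‖fderiv ℝ φ (x - t)‖ₑ ^ p ∂ν) := by
        refine lintegral_mono fun x => ?_
        rw [(hderiv x).fderiv]
        calc ‖∫ t, fderiv ℝ φ (x - t) ∂ν‖ₑ ^ p ≤ (∫⁻ t, ‖fderiv ℝ φ (x - t)‖ₑ ∂ν) ^ p :=
              ENNReal.rpow_le_rpow (enorm_integral_le_lintegral_enorm _) (by linarith)
          _ ≤ _ := lintegral_rpow_le_lintegral_rpow ν hp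
              ((measurable_fderiv ℝ φ).comp
                (measurable_const.sub measurable_id)).enorm.aemeasurable
    _ = ∫⁻ t, (∫⁻ x, ‖fderiv ℝ φ (x - t)‖ₑ ^ p) ∂ν :=
        lintegral_lintegral_swap hmeas.aemeasurable
    _ = ∫⁻ _, (∫⁻ x, ‖fderiv ℝ φ x‖ₑ ^ p) ∂ν := by
        congr 1 with t
        exact lintegral_sub_right_eq_self (fun x => ‖fderiv ℝ φ x‖ₑ ^ p) t
    _ = ∫⁻ x, ‖fderiv ℝ φ x‖ₑ ^ p := by simp

/-- A compactly supported Lipschitz function is a uniform limit of smooth functions supported in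
a given open neighbourhood of its support and with no larger `p`-energy. -/
lemma LipschitzWith.exists_contDiff_approx (hp : 1 < p) {Ω : Set 𝔼} (hopen : IsOpen Ω)
    {φ : 𝔼 → ℝ} {L : ℝ≥0} (hL : LipschitzWith L φ) (hc : HasCompactSupport φ)
    (hsub : tsupport φ ⊆ Ω) {ε : ℝ} (hε : 0 < ε) :
    ∃ ψ : 𝔼 → ℝ, ContDiff ℝ (⊤ : ℕ∞) ψ ∧ HasCompactSupport ψ ∧ tsupport ψ ⊆ Ω ∧
      (∀ x, |ψ x - φ x| ≤ ε) ∧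
      ∫⁻ x, ‖fderiv ℝ ψ x‖ₑ ^ p ≤ ∫⁻ x, ‖fderiv ℝ φ x‖ₑ ^ p := by
  obtain ⟨η, hη, hηsub⟩ := IsCompact.exists_cthickening_subset_open hc hopen hsub
  set r : ℝ := min η (ε / (L + 1)) with hr
  have hL1 : (0 : ℝ) < L + 1 := by positivity
  have hr0 : 0 < r := lt_min hη (div_pos hε hL1)
  let ρ : ContDiffBump (0 : 𝔼) := ⟨r / 2, r, by positivity, by linarith⟩
  have hρ : ρ.rOut = r := rfl
  set w : 𝔼 → ℝ := ρ.normed volume with hw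
  have hw0 : ∀ x, 0 ≤ w x := ρ.nonneg_normed
  have hwc : Continuous w := ρ.continuous_normed
  let ν : Measure 𝔼 := volume.withDensity fun x => ENNReal.ofReal (w x)
  have hνp : IsProbabilityMeasure ν := by
    constructor
    rw [withDensity_apply _ MeasurableSet.univ, Measure.restrict_univ,
      ← ofReal_integral_eq_lintegral_ofReal ρ.integrable_normed (Eventually.of_forall hw0),
      ρ.integral_normed, ENNReal.ofReal_one]
  have hψ : convolution w φ (ContinuousLinearMap.lsmul ℝ ℝ) volume = fun x => ∫ t, φ (x - t) ∂ν := by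
    ext x
    rw [integral_withDensity_eq_integral_toReal_smul hwc.measurable.ennreal_ofReal
      (Eventually.of_forall fun _ => ENNReal.ofReal_lt_top)]
    simp [convolution, ENNReal.toReal_ofReal (hw0 _)]
  have hts : tsupport (convolution w φ (ContinuousLinearMap.lsmul ℝ ℝ) volume) ⊆
      cthickening η (tsupport φ) := by
    refine closure_minimal (fun x hx => ?_) isClosed_cthickening
    obtain ⟨a, ha, b, hb, rfl⟩ := support_convolution_subset _ hx
    rw [hw, ρ.support_normed_eq, mem_ball_zero_iff, hρ] at ha
    refine mem_cthickening_of_dist_le _ b _ _ (subset_tsupport _ hb) ?_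
    simpa using ha.le.trans (min_le_left _ _)
  refine ⟨_, ρ.hasCompactSupport_normed.contDiff_convolution_left _ ρ.contDiff_normed
    hL.continuous.locallyIntegrable, ρ.hasCompactSupport_normed.convolution _ hc,
    hts.trans hηsub, fun x => ?_, ?_⟩
  · rw [← Real.dist_eq]
    refine ρ.dist_normed_convolution_le hL.continuous.aestronglyMeasurable fun y hy => ?_
    rw [hρ, mem_ball] at hy
    calc dist (φ y) (φ x) ≤ L * dist y x := hL.dist_le_mul y x
      _ ≤ (L + 1) * (ε / (L + 1)) := by
        have := hy.le.trans (min_le_right _ _)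
        gcongr
        linarith
      _ = ε := by field_simp
  · rw [← hw, hψ]
    exact hL.lintegral_fderiv_average_le hp hc ν (withDensity_absolutelyContinuous _ _)

/-- The smooth trace inequality yields the capacitary bound for compact sets. -/
lemma measure_le_pCap_of_trace_inequality (hp : 1 < p) {Ω : Set 𝔼} (hopen : IsOpen Ω)
    {ν : Measure 𝔼} {C : ℝ≥0}
    (h : ∀ ψ : 𝔼 → ℝ, ContDiff ℝ (⊤ : ℕ∞) ψ → HasCompactSupport ψ → tsupport ψ ⊆ Ω →
      ∫⁻ x in Ω, ‖ψ x‖ₑ ^ p ∂ν ≤ C * ∫⁻ x, ‖fderiv ℝ ψ x‖ₑ ^ p)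
    {z : 𝔼} {r : ℝ} (hr : 0 < r) (hz : ball z (2 * r) ⊆ Ω) {K : Set 𝔼} (hK : IsCompact K)
    (hKr : K ⊆ ball z r) (hKν : ν K ≠ ⊤) :
    ν K ≤ (C + 1 : ℝ≥0) * ENNReal.ofReal (pCap n p K Ω) := by
  have hp0 : 0 < p := by linarith
  have hKΩ : K ⊆ Ω := hKr.trans ((ball_subset_ball (by linarith)).trans hz)
  have hC0 : ((C + 1 : ℝ≥0) : ℝ≥0∞) ≠ 0 := by simp
  have hCt : ((C + 1 : ℝ≥0) : ℝ≥0∞) ≠ ⊤ := ENNReal.coe_ne_top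
  rw [← ENNReal.div_le_iff' hC0 hCt]
  have hts := (tsupport_radialCutoff_subset z hr)
  refine le_ofReal_pCap hp (radialCutoff_lipschitz z hr)
    (HasCompactSupport.of_support_subset_isCompact (isCompact_closedBall z (3 * r / 2))
      ((subset_tsupport _).trans hts))
    (hts.trans ((closedBall_subset_ball (by linarith)).trans hz))
    (fun x hx => (radialCutoff_eq_one hr (mem_ball.1 (hKr hx)).le).ge)
    (ENNReal.div_ne_top hKν hC0) fun φ L hL hc hsub hφ => ?_
  rw [ENNReal.div_le_iff' hC0 hCt]
  have key : ∀ ε : ℝ, 0 < ε → ε < 1 → ENNReal.ofReal (1 - ε) ^ p * ν K ≤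
      (C + 1 : ℝ≥0) * ∫⁻ x, ‖fderiv ℝ φ x‖ₑ ^ p := by
    intro ε hε hε1
    obtain ⟨ψ, hψ, hψc, hψsub, hψφ, hψe⟩ := hL.exists_contDiff_approx hp hopen hc hsub hε
    calc ENNReal.ofReal (1 - ε) ^ p * ν K
        = ∫⁻ _ in K, ENNReal.ofReal (1 - ε) ^ p ∂ν := by rw [setLIntegral_const]
      _ ≤ ∫⁻ x in K, ‖ψ x‖ₑ ^ p ∂ν := by
        refine setLIntegral_mono' hK.measurableSet fun x hx => ?_
        refine ENNReal.rpow_le_rpow ?_ hp0.le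
        rw [Real.enorm_eq_ofReal_abs]
        refine ENNReal.ofReal_le_ofReal ?_
        have h1 := abs_le.1 (hψφ x)
        have h2 := hφ x hx
        exact le_trans (by linarith) (le_abs_self _)
      _ ≤ ∫⁻ x in Ω, ‖ψ x‖ₑ ^ p ∂ν := lintegral_mono_set hKΩ
      _ ≤ C * ∫⁻ x, ‖fderiv ℝ ψ x‖ₑ ^ p := h ψ hψ hψc hψsub
      _ ≤ _ := by gcongr; simp
  have hlim : Tendsto (fun ε : ℝ => ENNReal.ofReal (1 - ε) ^ p * ν K) (𝓝[>] 0) (𝓝 (ν K)) := by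
    have h1 : Tendsto (fun ε : ℝ => ENNReal.ofReal (1 - ε) ^ p) (𝓝[>] 0) (𝓝 (1 : ℝ≥0∞)) := by
      have : Continuous fun ε : ℝ => ENNReal.ofReal (1 - ε) ^ p :=
        (ENNReal.continuous_rpow_const).comp
          (ENNReal.continuous_ofReal.comp (continuous_const.sub continuous_id))
      have h2 := (this.tendsto 0).mono_left (nhdsWithin_le_nhds (s := Ioi (0 : ℝ)))
      simpa using h2
    simpa using ENNReal.Tendsto.mul_const h1 (Or.inl one_ne_zero)
  refine le_of_tendsto hlim ?_
  filter_upwards [Ioo_mem_nhdsGT (zero_lt_one' ℝ)] with ε hε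
  exact key ε hε.1 hε.2

end Mollification

section Density

variable {n : ℕ} {p : ℝ}

local notation "𝔼" => EuclideanSpace ℝ (Fin n)

lemma ofReal_setIntegral_eq_withDensity {Ω : Set 𝔼} {V : 𝔼 → ℝ} (hV0 : ∀ x ∈ Ω, 0 ≤ V x)
    (hVloc : LocallyIntegrableOn V Ω) {K : Set 𝔼} (hK : IsCompact K) (hKΩ : K ⊆ Ω) :
    ENNReal.ofReal (∫ x in K, V x) =
      (volume.restrict Ω).withDensity (fun x => ENNReal.ofReal (V x)) K := by
  rw [withDensity_apply _ hK.measurableSet, Measure.restrict_restrict hK.measurableSet,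
    inter_eq_left.2 hKΩ, ofReal_integral_eq_lintegral_ofReal
      (hVloc.integrableOn_compact_subset hKΩ hK)
      ((ae_restrict_iff' hK.measurableSet).2 (Eventually.of_forall fun x hx => hV0 x (hKΩ hx)))]

lemma ofReal_setIntegral_mul_eq_lintegral_withDensity (hp : 1 < p) {Ω : Set 𝔼} {V : 𝔼 → ℝ}
    (hopen : IsOpen Ω) (hV0 : ∀ x ∈ Ω, 0 ≤ V x) (hVloc : LocallyIntegrableOn V Ω) {φ : 𝔼 → ℝ}
    (hφ : Continuous φ) (hc : HasCompactSupport φ) (hsub : tsupport φ ⊆ Ω) :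
    ENNReal.ofReal (∫ x in Ω, |φ x| ^ p * V x) = ∫⁻ x in Ω, ‖φ x‖ₑ ^ p
      ∂((volume.restrict Ω).withDensity fun x => ENNReal.ofReal (V x)) := by
  have hp0 : 0 < p := by linarith
  have hint : Integrable fun x => |φ x| ^ p * V x := by
    rw [← integrableOn_iff_integrable_of_support_subset (s := tsupport φ)]
    · exact (hVloc.integrableOn_compact_subset hsub hc).continuousOn_mul
        (hφ.abs.rpow_const fun _ => Or.inr hp0.le).continuousOn hc
    · refine fun x hx => subset_tsupport _ fun h0 => hx ?_
      simp [h0, Real.zero_rpow hp0.ne']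
  rw [ofReal_integral_eq_lintegral_ofReal hint.integrableOn
      ((ae_restrict_iff' hopen.measurableSet).2
        (Eventually.of_forall fun x hx => mul_nonneg (by positivity) (hV0 x hx))),
    restrict_withDensity hopen.measurableSet, Measure.restrict_restrict hopen.measurableSet,
    inter_self, lintegral_withDensity_eq_lintegral_mul₀
      hVloc.aestronglyMeasurable.aemeasurable.ennreal_ofReal
      (hφ.measurable.enorm.pow_const p).aemeasurable]
  refine setLIntegral_congr_fun hopen.measurableSet fun x hx => ?_
  simp only [Pi.mul_apply]
  rw [ENNReal.ofReal_mul (by positivity), mul_comm, Real.enorm_eq_ofReal_abs,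
    ENNReal.ofReal_rpow_of_nonneg (abs_nonneg _) hp0.le]

lemma pCap_nonneg (K U : Set 𝔼) : 0 ≤ pCap n p K U := by
  refine Real.sInf_nonneg ?_
  rintro c ⟨φ, -, -, -, -, rfl⟩
  exact integral_nonneg fun x => by positivity

end Density

end Auxiliary

/-- **Characterization of the trace inequality** (Theorem 4.3, Euclidean case): for `Ω` with
uniformly `p`-fat complement and `V ≥ 0` locally integrable on `Ω`, the trace inequality
`∫_Ω |φ|^p V ≤ C ∫_Ω |∇φ|^p` holds iff `∫_K V ≤ C' cap_p(K,Ω)` for all compact subsets `K`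
of the Whitney-type balls `B(x, δ(x)/100)`, `x ∈ Ω`. -/
theorem trace_inequality_characterization (n : ℕ) (hn : 3 ≤ n) (p : ℝ)
    (hp : 1 < p) (hpn : p < n)
    (Ω : Set (EuclideanSpace ℝ (Fin n)))
    (hb : Bornology.IsBounded Ω) (hconn : IsConnected Ω) (hopen : IsOpen Ω)
    (c₀ r₀ : ℝ) (hc₀ : 0 < c₀) (hr₀ : 0 < r₀) (hfat : UniformlyFat n p c₀ r₀ Ωᶜ)
    (V : EuclideanSpace ℝ (Fin n) → ℝ) (hV0 : ∀ x ∈ Ω, 0 ≤ V x)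
    (hVloc : LocallyIntegrableOn V Ω) :
    (∃ C : ℝ, 0 < C ∧
      ∀ φ : EuclideanSpace ℝ (Fin n) → ℝ, ContDiff ℝ (⊤ : ℕ∞) φ → HasCompactSupport φ →
        tsupport φ ⊆ Ω →
        (∫ x in Ω, |φ x| ^ p * V x) ≤ C * ∫ x in Ω, ‖fderiv ℝ φ x‖ ^ p) ↔
    (∃ C' : ℝ, 0 < C' ∧
      ∀ x ∈ Ω, ∀ K : Set (EuclideanSpace ℝ (Fin n)), IsCompact K →
        K ⊆ ball x (Metric.infDist x (frontier Ω) / 100) →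
        (∫ y in K, V y) ≤ C' * pCap n p K Ω) := by
  have hn0 : 0 < n := by omega
  have hne := hconn.nonempty
  constructor
  · rintro ⟨C, hC, h⟩
    refine ⟨C.toNNReal + 1, by positivity, fun x hx K hK hKx => ?_⟩
    have hd := infDist_frontier_pos hn0 hb hopen hx
    have hdsub := ball_infDist_frontier_subset hopen hx
    have hKΩ : K ⊆ Ω := hKx.trans ((ball_subset_ball (by linarith)).trans hdsub)
    have hνK := ofReal_setIntegral_eq_withDensity hV0 hVloc hK hKΩ
    have key := measure_le_pCap_of_trace_inequality (C := C.toNNReal) hp hopen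
      (ν := (volume.restrict Ω).withDensity fun x => ENNReal.ofReal (V x))
      (fun ψ hψ hψc hψsub => by
        obtain ⟨L, hL⟩ := hψ.lipschitzWith_of_hasCompactSupport hψc (by simp)
        rw [← ofReal_setIntegral_mul_eq_lintegral_withDensity hp hopen hV0 hVloc hψ.continuous
          hψc hψsub, ← ofReal_setIntegral_norm_fderiv hp hL hψc hψsub]
        change _ ≤ ENNReal.ofReal C * _
        rw [← ENNReal.ofReal_mul hC.le]
        exact ENNReal.ofReal_le_ofReal (h ψ hψ hψc hψsub))
      (div_pos hd (by norm_num)) ((ball_subset_ball (by linarith)).trans hdsub) hK hKx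
      (hνK ▸ ENNReal.ofReal_ne_top)
    rw [← hνK, ← ENNReal.ofReal_coe_nnreal, ← ENNReal.ofReal_mul NNReal.zero_le_coe] at key
    refine ((ENNReal.ofReal_le_ofReal_iff
      (mul_nonneg NNReal.zero_le_coe (pCap_nonneg _ _))).1 key).trans_eq ?_
    push_cast
    rfl
  · rintro ⟨C', hC', h⟩
    obtain ⟨C, hC⟩ := exists_trace_inequality hn0 hp hb hopen hne hc₀ hr₀ hfat
      (ν := (volume.restrict Ω).withDensity fun x => ENNReal.ofReal (V x)) (Q := C'.toNNReal)
      (fun x hx K hK hKx => by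
        have hd := infDist_frontier_pos hn0 hb hopen hx
        have hKΩ : K ⊆ Ω := hKx.trans
          ((ball_subset_ball (by linarith)).trans (ball_infDist_frontier_subset hopen hx))
        rw [← ofReal_setIntegral_eq_withDensity hV0 hVloc hK hKΩ]
        change _ ≤ ENNReal.ofReal C' * _
        rw [← ENNReal.ofReal_mul hC'.le]
        exact ENNReal.ofReal_le_ofReal (h x hx K hK hKx))
    refine ⟨C + 1, by positivity, fun φ hφ hc hsub => ?_⟩
    obtain ⟨L, hL⟩ := hφ.lipschitzWith_of_hasCompactSupport hc (by simp)
    have key := hC φ L hL hc hsub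
    have hI : 0 ≤ ∫ x in Ω, ‖fderiv ℝ φ x‖ ^ p := integral_nonneg fun x => by positivity
    rw [← ofReal_setIntegral_mul_eq_lintegral_withDensity hp hopen hV0 hVloc hφ.continuous hc
      hsub, ← ofReal_setIntegral_norm_fderiv hp hL hc hsub, ← ENNReal.ofReal_coe_nnreal,
      ← ENNReal.ofReal_mul NNReal.zero_le_coe,
      ENNReal.ofReal_le_ofReal_iff (mul_nonneg NNReal.zero_le_coe hI)] at key
    linarith
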